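/- A subgroup H of F is the centralizer in F of a single element of F if and only if there exist n ∈ ℕ, subgroups H₁, …, Hₙ of F, and points α₀, …, αₙ ∈ A with 0 = α₀ < α₁ < ⋯ < αₙ = r such that: (1) H is the internal direct product of H₁, …, Hₙ; (2) for every i = 1, …, n, either Hᵢ = F_{(α_{i−1},α_i)}, or there exists x ∈ F_{(α_{i−1},α_i)} such that Hᵢ is the centralizer of x in F_{(α_{i−1},α_i)} and Hᵢ = ⟨x⟩; (3) for every i = 1, …, n−1, if Hᵢ = F_{(α_{i−1},α_i)} then H_{i+1} ≠ F_{(α_i,α_{i+1})}. -/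

import Mathlib

open Set

/-- `L` (the `Λ` of the paper) is a subgroup of the multiplicative group of positive reals. -/
def IsSlopeSubgroup (L : Set ℝ) : Prop :=
  (∀ p ∈ L, (0:ℝ) < p) ∧ (1:ℝ) ∈ L ∧ (∀ p ∈ L, ∀ q ∈ L, p * q ∈ L) ∧ ∀ p ∈ L, p⁻¹ ∈ L

/-- `A` is an additive subgroup of `ℝ`, containing `r`, stable under multiplication
by the elements of `L`. -/
def IsSlopeModule (r : ℝ) (L A : Set ℝ) : Prop :=
  r ∈ A ∧ (0:ℝ) ∈ A ∧ (∀ a ∈ A, ∀ b ∈ A, a + b ∈ A) ∧ (∀ a ∈ A, -a ∈ A) ∧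
    ∀ p ∈ L, ∀ a ∈ A, p * a ∈ A

/-- The support of a permutation of `ℝ`. -/
def psupp (f : Equiv.Perm ℝ) : Set ℝ := {x | f x ≠ x}

/-- `f` is affine with slope `k` on the set `s`. -/
def AffOn (f : ℝ → ℝ) (s : Set ℝ) (k : ℝ) : Prop := ∃ m, ∀ x ∈ s, f x = k * x + m

/-- `f` is piecewise affine with finitely many breakpoints, all breakpoints
(necessarily lying in `[0,r]`) and their images lying in `A`, and all slopes in `L`. -/
def PiecewiseAffine (r : ℝ) (L A : Set ℝ) (f : Equiv.Perm ℝ) : Prop :=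
  ∃ B : Finset ℝ, (B : Set ℝ) ⊆ A ∩ Icc 0 r ∧ (∀ x ∈ B, f x ∈ A) ∧
    ∀ x : ℝ, x ∉ (B : Set ℝ) → ∃ ε > 0, ∃ k ∈ L, AffOn (⇑f) (Ioo (x - ε) (x + ε)) k

/-- Membership in the group `F(r,L,A)`.  We model bijections of `[0,r)` onto itself
as permutations of `ℝ` fixing the complement of `[0,r)` pointwise.  An element of
`F(r,L,A)` is such a permutation which is continuous (equivalently, its restriction
to `[0,r)` is a homeomorphism of `[0,r)` for the usual topology) and piecewise
affine with all slopes in `L` and all breakpoints, together with their images, in `A`. -/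
def memF (r : ℝ) (L A : Set ℝ) (f : Equiv.Perm ℝ) : Prop :=
  (∀ x : ℝ, x ∉ Ico (0:ℝ) r → f x = x) ∧ Continuous ⇑f ∧ PiecewiseAffine r L A f

/-- Membership in `F_S(r,L,A) = {x ∈ F(r,L,A) : supp x ⊆ S}`. -/
def memFS (r : ℝ) (L A : Set ℝ) (S : Set ℝ) (f : Equiv.Perm ℝ) : Prop :=
  memF r L A f ∧ psupp f ⊆ S

/-- `f` has right slope `k` at `a`: `f` is affine with slope `k` on an interval
immediately to the right of `a`. -/
def HasRightSlope (f : ℝ → ℝ) (a k : ℝ) : Prop := ∃ b > a, AffOn f (Ioo a b) k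

/-- `f` has left slope `k` at `b`: `f` is affine with slope `k` on an interval
immediately to the left of `b`. -/
def HasLeftSlope (f : ℝ → ℝ) (b k : ℝ) : Prop := ∃ a < b, AffOn f (Ioo a b) k

/-- `H` is the internal direct product of the subgroups `Hs 0, …, Hs (n-1)`:
elements of distinct factors commute, and every element of `H` is, in a unique way,
the product of one element from each factor (in increasing order of the index). -/
def IsInternalDirectProduct {G : Type*} [Group G] (H : Subgroup G) (n : ℕ)
    (Hs : ℕ → Subgroup G) : Prop :=
  (∀ i < n, ∀ j < n, i ≠ j → ∀ x ∈ Hs i, ∀ y ∈ Hs j, Commute x y) ∧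
  ∀ g : G, g ∈ H ↔
    ∃! t : (i : Fin n) → ↥(Hs (i : ℕ)),
      g = (List.ofFn fun i : Fin n => ((t i : G))).prod

/-- `f` is affine on each side of `x`, with slopes in `L`, and has no breakpoint at `x`
unless `x` lies in `A`. -/
def LocallyPL (L A : Set ℝ) (f : ℝ → ℝ) (x : ℝ) : Prop :=
  ∃ ε > 0, ∃ k ∈ L, ∃ l ∈ L, (∀ y, x ≤ y → y < x + ε → f y = f x + k * (y - x)) ∧
    (∀ y, x - ε < y → y ≤ x → f y = f x + l * (y - x)) ∧ (x ∉ A → k = l)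

lemma exists_affOn_of_locally {L : Set ℝ} {f : ℝ → ℝ} {a b : ℝ} (hab : a < b)
    (h : ∀ x ∈ Ioo a b, ∃ ε > 0, ∃ k ∈ L, AffOn f (Ioo (x - ε) (x + ε)) k) :
    ∃ k ∈ L, AffOn f (Ioo a b) k := by
  have hderiv : ∀ x ∈ Ioo a b, ∃ ε > 0, ∃ k ∈ L,
      ∀ y ∈ Ioo (x - ε) (x + ε), HasDerivAt f k y := by
    intro x hx
    obtain ⟨ε, hε, k, hk, m, hm⟩ := h x hx
    refine ⟨ε, hε, k, hk, fun y hy => ?_⟩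
    have h1 : HasDerivAt (fun z : ℝ => k * z + m) k y := by
      simpa using ((hasDerivAt_id y).const_mul k).add_const m
    refine h1.congr_of_eventuallyEq ?_
    filter_upwards [Ioo_mem_nhds hy.1 hy.2] with z hz using hm z hz
  have hconst : ∀ x ∈ Ioo a b, ∀ y ∈ Ioo a b, deriv f x = deriv f y := by
    intro x hx y hy
    have hdiff : DifferentiableOn ℝ (deriv f) (Ioo a b) := by
      intro z hz
      obtain ⟨ε, hε, k, hk, hd⟩ := hderiv z hz
      refine DifferentiableAt.differentiableWithinAt ?_
      refine (differentiableAt_const k).congr_of_eventuallyEq ?_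
      filter_upwards [Ioo_mem_nhds (show z - ε < z by linarith) (show z < z + ε by linarith)]
        with w hw using (hd w hw).deriv
    refine isOpen_Ioo.is_const_of_deriv_eq_zero isPreconnected_Ioo hdiff ?_ hx hy
    intro z hz
    obtain ⟨ε, hε, k, hk, hd⟩ := hderiv z hz
    have : deriv f =ᶠ[nhds z] fun _ => k := by
      filter_upwards [Ioo_mem_nhds (show z - ε < z by linarith) (show z < z + ε by linarith)]
        with w hw using (hd w hw).deriv
    rw [this.deriv_eq]; simp
  have hmid : (a + b) / 2 ∈ Ioo a b := ⟨by linarith, by linarith⟩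
  obtain ⟨ε, hε, k, hk, hd⟩ := hderiv _ hmid
  have hk' : ∀ x ∈ Ioo a b, HasDerivAt f k x := by
    intro x hx
    obtain ⟨ε', hε', k', hk', hd'⟩ := hderiv x hx
    have h1 := hd' x ⟨by linarith, by linarith⟩
    have h2 := hd ((a + b) / 2) ⟨by linarith, by linarith⟩
    have := hconst x hx _ hmid
    rw [h1.deriv, h2.deriv] at this
    rwa [← this]
  refine ⟨k, hk, f ((a + b) / 2) - k * ((a + b) / 2), fun x hx => ?_⟩
  have hg : ∀ x ∈ Ioo a b, HasDerivAt (fun z => f z - k * z) 0 x := by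
    intro x hx
    have h1 : HasDerivAt (fun z : ℝ => k * z) k x := by
      simpa using (hasDerivAt_id x).const_mul k
    simpa using (hk' x hx).fun_sub h1
  have : f x - k * x = f ((a + b) / 2) - k * ((a + b) / 2) :=
    isOpen_Ioo.is_const_of_deriv_eq_zero isPreconnected_Ioo
      (fun z hz => (hg z hz).differentiableAt.differentiableWithinAt)
      (fun z hz => (hg z hz).deriv) hx hmid
  linarith

lemma exists_slope_of_locally {L : Set ℝ} {f : ℝ → ℝ} {a b : ℝ} (hab : a < b)
    (hf : Continuous f)
    (h : ∀ x ∈ Ioo a b, ∃ ε > 0, ∃ k ∈ L, AffOn f (Ioo (x - ε) (x + ε)) k) :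
    ∃ k ∈ L, ∀ x ∈ Icc a b, ∀ y ∈ Icc a b, f y = f x + k * (y - x) := by
  obtain ⟨k, hk, m, hm⟩ := exists_affOn_of_locally hab h
  have : EqOn f (fun x => k * x + m) (Icc a b) := by
    rw [← closure_Ioo hab.ne]
    exact Set.EqOn.closure (fun x hx => hm x hx) hf (by fun_prop)
  refine ⟨k, hk, fun x hx y hy => ?_⟩
  have h1 := this hx
  have h2 := this hy
  simp only at h1 h2
  rw [h1, h2]; ring

lemma IsCompact.finite_of_isolated {K : Set ℝ} (hK : IsCompact K)
    (h : ∀ p ∈ K, ∃ ε > 0, ∀ z ∈ K, p - ε < z → z < p + ε → z = p) : K.Finite := by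
  choose! ε hε hz using h
  obtain ⟨t, ht⟩ := hK.elim_nhds_subcover' (fun p _ => Ioo (p - ε p) (p + ε p))
    (fun p hp => Ioo_mem_nhds (by linarith [hε p hp]) (by linarith [hε p hp]))
  refine (t.finite_toSet.image Subtype.val).subset fun z hzK => ?_
  obtain ⟨p, hp, hzp⟩ := mem_iUnion₂.1 (ht hzK)
  exact ⟨p, hp, (hz p p.2 z hzK hzp.1 hzp.2).symm⟩

lemma memF.locallyPL {r : ℝ} {L A : Set ℝ} {f : Equiv.Perm ℝ} (hf : memF r L A f) (x : ℝ) :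
    LocallyPL L A f x := by
  obtain ⟨-, hc, B, hB, -, hloc⟩ := hf
  have hfin : ((B : Set ℝ) \ {x}).Finite := B.finite_toSet.subset sdiff_subset
  obtain ⟨ε, hε, hball⟩ := Metric.isOpen_iff.1 hfin.isClosed.isOpen_compl x (by simp)
  have hnot : ∀ y, x - ε < y → y < x + ε → y ≠ x → y ∉ (B : Set ℝ) := by
    intro y h1 h2 h3 h4
    exact hball (show y ∈ Metric.ball x ε by
      rw [Metric.mem_ball, Real.dist_eq, abs_lt]; constructor <;> linarith) ⟨h4, h3⟩
  obtain ⟨k, hk, h1⟩ := exists_slope_of_locally (L := L) (show x < x + ε by linarith) hc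
    (fun y hy => hloc y (hnot y (by linarith [hy.1]) hy.2 hy.1.ne'))
  obtain ⟨l, hl, h2⟩ := exists_slope_of_locally (L := L) (show x - ε < x by linarith) hc
    (fun y hy => hloc y (hnot y hy.1 (by linarith [hy.2]) hy.2.ne))
  refine ⟨ε, hε, k, hk, l, hl, fun y hy hy' => h1 x ⟨le_rfl, by linarith⟩ y ⟨hy, hy'.le⟩,
    fun y hy hy' => h2 x ⟨by linarith, le_rfl⟩ y ⟨hy.le, hy'⟩, fun hxA => ?_⟩
  obtain ⟨δ, hδ, m, -, c, hm⟩ := hloc x (fun h => hxA (hB h).1)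
  set η := min ε δ / 2 with hη
  have hη0 : 0 < η := by positivity
  have hηε : η < ε := by have := min_le_left ε δ; have : 0 < min ε δ := by positivity
                         linarith
  have hηδ : η < δ := by have := min_le_right ε δ; have : 0 < min ε δ := by positivity
                         linarith
  have e1 := h1 x ⟨le_rfl, by linarith⟩ (x + η) ⟨by linarith, by linarith⟩
  have e2 := h2 x ⟨by linarith, le_rfl⟩ (x - η) ⟨by linarith, by linarith⟩
  rw [hm (x + η) ⟨by linarith, by linarith⟩, hm x ⟨by linarith, by linarith⟩] at e1
  rw [hm (x - η) ⟨by linarith, by linarith⟩, hm x ⟨by linarith, by linarith⟩] at e2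
  have : k * η = l * η := by linarith
  exact mul_right_cancel₀ hη0.ne' this

lemma memF.map_zero {r : ℝ} {L A : Set ℝ} {f : Equiv.Perm ℝ} (hf : memF r L A f) : f 0 = 0 := by
  have : EqOn f id (Iic 0) := by
    rw [← closure_Iio]
    exact Set.EqOn.closure (fun x hx => hf.1 x fun h => not_lt.2 h.1 hx) hf.2.1 continuous_id
  exact this self_mem_Iic

lemma memF.mem_iff {r : ℝ} {L A : Set ℝ} (hL : IsSlopeSubgroup L) (hA : IsSlopeModule r L A)
    {f : Equiv.Perm ℝ} (hf : memF r L A f) (x : ℝ) : f x ∈ A ↔ x ∈ A := by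
  by_cases hx : x ∈ Ico 0 r
  swap
  · rw [hf.1 x hx]
  have h0 := hf.map_zero
  obtain ⟨-, hc, B, hB, hBA, hloc⟩ := hf
  obtain ⟨-, h0A, hadd, hneg, hmul⟩ := hA
  obtain ⟨b, hb, hmax⟩ := ((insert 0 B).filter (· ≤ x)).exists_max_image id
    ⟨0, by simp [hx.1]⟩
  simp only [Finset.mem_filter, Finset.mem_insert, id] at hb hmax
  have hbA : b ∈ A := by
    rcases hb.1 with h | h
    · rwa [h]
    · exact (hB h).1
  have hfbA : f b ∈ A := by
    rcases hb.1 with h | h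
    · rwa [h, h0]
    · exact hBA b h
  rcases hb.2.eq_or_lt with h | h
  · rw [← h]; exact iff_of_true hfbA hbA
  obtain ⟨k, hk, h1⟩ := exists_slope_of_locally (L := L) h hc
    (fun y hy => hloc y (fun hyB => by
      have := hmax y ⟨Or.inr hyB, hy.2.le⟩
      linarith [hy.1]))
  have e := h1 b ⟨le_rfl, h.le⟩ x ⟨h.le, le_rfl⟩
  constructor
  · intro hfx
    have h2 := hmul _ (hL.2.2.2 k hk) _ (hadd _ hfx _ (hneg _ hfbA))
    have hk0 := hL.1 k hk
    have h3 : x = k⁻¹ * (f x + -f b) + b := by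
      rw [e]; field_simp; ring
    rw [h3]
    exact hadd _ h2 _ hbA
  · intro hxA
    rw [e]
    exact hadd _ hfbA _ (hmul k hk _ (by rw [sub_eq_add_neg]; exact hadd _ hxA _ (hneg _ hbA)))

lemma LocallyPL.continuousAt {L A : Set ℝ} {f : ℝ → ℝ} {x : ℝ} (h : LocallyPL L A f x) :
    ContinuousAt f x := by
  obtain ⟨ε, hε, k, -, l, -, h1, h2, -⟩ := h
  refine continuousAt_iff_continuous_left_right.2 ⟨?_, ?_⟩
  · have : ContinuousWithinAt (fun y => f x + l * (y - x)) (Iic x) x := by fun_prop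
    refine this.congr_of_eventuallyEq ?_ (by simp)
    filter_upwards [Ioc_mem_nhdsLE (show x - ε < x by linarith)] with y hy using h2 y hy.1 hy.2
  · have : ContinuousWithinAt (fun y => f x + k * (y - x)) (Ici x) x := by fun_prop
    refine this.congr_of_eventuallyEq ?_ (by simp)
    filter_upwards [Ico_mem_nhdsGE (show x < x + ε by linarith)] with y hy using h1 y hy.1 hy.2

lemma memF_of_locallyPL {r : ℝ} {L A : Set ℝ} (hL : IsSlopeSubgroup L) {f : Equiv.Perm ℝ}
    (hsupp : ∀ x ∉ Ico (0:ℝ) r, f x = x) (hloc : ∀ x, LocallyPL L A f x)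
    (hAA : ∀ x ∈ A, f x ∈ A) : memF r L A f := by
  refine ⟨hsupp, continuous_iff_continuousAt.2 fun x => (hloc x).continuousAt, ?_⟩
  set U : Set ℝ := {x | ∃ ε > 0, ∃ k ∈ L, AffOn f (Ioo (x - ε) (x + ε)) k} with hU
  have hUo : IsOpen U := by
    rw [Metric.isOpen_iff]
    rintro x ⟨ε, hε, k, hk, m, hm⟩
    refine ⟨ε / 2, by positivity, fun y hy => ⟨ε / 2, by positivity, k, hk, m, fun z hz => hm z ?_⟩⟩
    rw [Metric.mem_ball, Real.dist_eq, abs_lt] at hy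
    exact ⟨by linarith [hz.1], by linarith [hz.2]⟩
  have hsub : Uᶜ ⊆ Icc 0 r := by
    intro x hx
    by_contra hx'
    refine hx ?_
    obtain ⟨ε, hε, hb⟩ :=
      Metric.isOpen_iff.1 (isClosed_Icc (a := (0:ℝ)) (b := r)).isOpen_compl x hx'
    refine ⟨ε, hε, 1, hL.2.1, 0, fun z hz => ?_⟩
    rw [one_mul, add_zero]
    refine hsupp z fun hzI => @hb z ?_ (Ico_subset_Icc_self hzI)
    rw [Metric.mem_ball, Real.dist_eq, abs_lt]
    exact ⟨by linarith [hz.1], by linarith [hz.2]⟩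
  have hfin : Uᶜ.Finite := by
    refine (isCompact_Icc.of_isClosed_subset hUo.isClosed_compl hsub).finite_of_isolated ?_
    intro p _
    obtain ⟨ε, hε, k, hk, l, hl, h1, h2, -⟩ := hloc p
    refine ⟨ε, hε, fun z hz hz1 hz2 => ?_⟩
    by_contra hne
    refine hz ?_
    rcases lt_or_gt_of_ne hne with h | h
    · refine ⟨min (p - z) (z - (p - ε)), lt_min (by linarith) (by linarith), l, hl,
        f p - l * p, fun y hy => ?_⟩
      have := min_le_left (p - z) (z - (p - ε))
      have := min_le_right (p - z) (z - (p - ε))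
      rw [h2 y (by linarith [hy.1]) (by linarith [hy.2])]; ring
    · refine ⟨min (z - p) (p + ε - z), lt_min (by linarith) (by linarith), k, hk,
        f p - k * p, fun y hy => ?_⟩
      have := min_le_left (z - p) (p + ε - z)
      have := min_le_right (z - p) (p + ε - z)
      rw [h1 y (by linarith [hy.1]) (by linarith [hy.2])]; ring
  have hmemA : ∀ x ∈ Uᶜ, x ∈ A := by
    intro x hx
    by_contra hxA
    obtain ⟨ε, hε, k, hk, l, hl, h1, h2, h3⟩ := hloc x
    refine hx ⟨ε, hε, k, hk, f x - k * x, fun y hy => ?_⟩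
    rcases le_total x y with h | h
    · rw [h1 y h hy.2]; ring
    · rw [h2 y hy.1 h, h3 hxA]; ring
  refine ⟨hfin.toFinset, ?_, ?_, ?_⟩
  · rw [Set.Finite.coe_toFinset]
    exact fun x hx => ⟨hmemA x hx, hsub hx⟩
  · intro x hx
    rw [Set.Finite.mem_toFinset] at hx
    exact hAA x (hmemA x hx)
  · intro x hx
    rw [Set.Finite.coe_toFinset] at hx
    exact not_not.1 hx

lemma LocallyPL.glue {L A : Set ℝ} {f g h : ℝ → ℝ} {x ε : ℝ} (hf : LocallyPL L A f x)
    (hg : LocallyPL L A g x) (hx : x ∈ A) (hε : 0 < ε) (h1 : ∀ y, x - ε < y → y ≤ x → h y = f y)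
    (h2 : ∀ y, x ≤ y → y < x + ε → h y = g y) : LocallyPL L A h x := by
  obtain ⟨δ, hδ, k, hk, l, hl, -, hfl, -⟩ := hf
  obtain ⟨δ', hδ', k', hk', l', hl', hgr, -, -⟩ := hg
  have hp : 0 < min ε (min δ δ') := by positivity
  have m1 := min_le_left ε (min δ δ')
  have m2 := (min_le_right ε (min δ δ')).trans (min_le_left _ _)
  have m3 := (min_le_right ε (min δ δ')).trans (min_le_right _ _)
  refine ⟨min ε (min δ δ'), hp, k', hk', l, hl, fun y hy hy' => ?_, fun y hy hy' => ?_,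
    fun h => absurd hx h⟩
  · rw [h2 y hy (by linarith), h2 x le_rfl (by linarith), hgr y hy (by linarith)]
  · rw [h1 y (by linarith) hy', h1 x (by linarith) le_rfl, hfl y (by linarith) hy']

lemma LocallyPL.congr {L A : Set ℝ} {f h : ℝ → ℝ} {x : ℝ} {U : Set ℝ} (hf : LocallyPL L A f x)
    (hU : IsOpen U) (hx : x ∈ U) (h1 : EqOn h f U) : LocallyPL L A h x := by
  obtain ⟨δ, hδ, k, hk, l, hl, hfr, hfl, hkl⟩ := hf
  obtain ⟨ε, hε, hb⟩ := Metric.isOpen_iff.1 hU x hx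
  have h1' : ∀ y, x - ε < y → y < x + ε → h y = f y := fun y h2 h3 =>
    h1 (hb (by rw [Metric.mem_ball, Real.dist_eq, abs_lt]; constructor <;> linarith))
  have hp : 0 < min ε δ := by positivity
  have m1 := min_le_left ε δ
  have m2 := min_le_right ε δ
  refine ⟨min ε δ, hp, k, hk, l, hl, fun y hy hy' => ?_, fun y hy hy' => ?_, hkl⟩
  · rw [h1' y (by linarith) (by linarith), h1' x (by linarith) (by linarith),
      hfr y hy (by linarith)]
  · rw [h1' y (by linarith) (by linarith), h1' x (by linarith) (by linarith),
      hfl y (by linarith) hy']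

lemma locallyPL_id {L A : Set ℝ} (hL : IsSlopeSubgroup L) (x : ℝ) : LocallyPL L A id x :=
  ⟨1, one_pos, 1, hL.2.1, 1, hL.2.1, by simp, by simp, by simp⟩

lemma LocallyPL.comp {L A : Set ℝ} (hL : IsSlopeSubgroup L) {f g : ℝ → ℝ} {x : ℝ}
    (hf : LocallyPL L A f (g x)) (hg : LocallyPL L A g x) (hA : g x ∈ A → x ∈ A) :
    LocallyPL L A (f ∘ g) x := by
  obtain ⟨ε, hε, k, hk, l, hl, h1, h2, h3⟩ := hf
  obtain ⟨ε', hε', k', hk', l', hl', h1', h2', h3'⟩ := hg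
  have hk0 := hL.1 k' hk'
  have hl0 := hL.1 l' hl'
  have m1 := min_le_left ε' (min (ε / k') (ε / l'))
  have m2 := (min_le_right ε' (min (ε / k') (ε / l'))).trans (min_le_left _ _)
  have m3 := (min_le_right ε' (min (ε / k') (ε / l'))).trans (min_le_right _ _)
  refine ⟨min ε' (min (ε / k') (ε / l')), by positivity, k * k', hL.2.2.1 _ hk _ hk',
    l * l', hL.2.2.1 _ hl _ hl', fun y hy hy' => ?_, fun y hy hy' => ?_, fun hx => ?_⟩
  · have e := h1' y hy (by linarith)
    have h4 : y - x < ε / k' := by linarith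
    rw [lt_div_iff₀ hk0] at h4
    have h5 : 0 ≤ k' * (y - x) := mul_nonneg hk0.le (by linarith)
    simp only [Function.comp]
    rw [h1 (g y) (by linarith) (by linarith), e]; ring
  · have e := h2' y (by linarith) hy'
    have h4 : x - y < ε / l' := by linarith
    rw [lt_div_iff₀ hl0] at h4
    have h5 : 0 ≤ l' * (x - y) := mul_nonneg hl0.le (by linarith)
    simp only [Function.comp]
    rw [h2 (g y) (by linarith) (by linarith), e]; ring
  · rw [h3 fun h => hx (hA h), h3' hx]

lemma LocallyPL.symm {L A : Set ℝ} (hL : IsSlopeSubgroup L) {f : Equiv.Perm ℝ} {x : ℝ}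
    (hf : LocallyPL L A f x) (hA : x ∈ A → f x ∈ A) : LocallyPL L A (f⁻¹ : Equiv.Perm ℝ) (f x) := by
  obtain ⟨ε, hε, k, hk, l, hl, h1, h2, h3⟩ := hf
  have hk0 := hL.1 k hk
  have hl0 := hL.1 l hl
  have m1 := min_le_left (ε * k) (ε * l)
  have m2 := min_le_right (ε * k) (ε * l)
  refine ⟨min (ε * k) (ε * l), by positivity, k⁻¹, hL.2.2.2 k hk, l⁻¹, hL.2.2.2 l hl,
    fun y hy hy' => ?_, fun y hy hy' => ?_, fun hx => ?_⟩
  · rw [Equiv.Perm.inv_def, Equiv.symm_apply_apply, Equiv.symm_apply_eq]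
    have h4 : 0 ≤ k⁻¹ * (y - f x) := mul_nonneg (by positivity) (by linarith)
    have h5 : k⁻¹ * (y - f x) < ε := by
      rw [inv_mul_eq_div, div_lt_iff₀ hk0]; linarith
    rw [h1 _ (by linarith) (by linarith)]
    field_simp; ring
  · rw [Equiv.Perm.inv_def, Equiv.symm_apply_apply, Equiv.symm_apply_eq]
    have h4 : 0 ≤ l⁻¹ * (f x - y) := mul_nonneg (by positivity) (by linarith)
    have h5 : l⁻¹ * (f x - y) < ε := by
      rw [inv_mul_eq_div, div_lt_iff₀ hl0]; linarith
    rw [h2 _ (by linarith) (by linarith)]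
    field_simp; ring
  · rw [h3 fun h => hx (hA h)]

/-- The elements of `F(r,L,A)` as a subgroup of the permutations of `ℝ`. -/
def groupF {r : ℝ} {L A : Set ℝ} (hL : IsSlopeSubgroup L) (hA : IsSlopeModule r L A) :
    Subgroup (Equiv.Perm ℝ) where
  carrier := {f | memF r L A f}
  one_mem' := memF_of_locallyPL hL (fun _ _ => rfl) (locallyPL_id hL) (fun _ h => h)
  mul_mem' := by
    intro f g hf hg
    refine memF_of_locallyPL hL (fun x hx => ?_)
      (fun x => (hf.locallyPL (g x)).comp hL (hg.locallyPL x) (hg.mem_iff hL hA x).1)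
      (fun x hx => (hf.mem_iff hL hA _).2 ((hg.mem_iff hL hA _).2 hx))
    rw [Equiv.Perm.mul_apply, hg.1 x hx, hf.1 x hx]
  inv_mem' := by
    intro f hf
    refine memF_of_locallyPL hL (fun x hx => ?_) (fun x => ?_) (fun x hx => ?_)
    · rw [Equiv.Perm.inv_eq_iff_eq, hf.1 x hx]
    · have := (hf.locallyPL (f⁻¹ x)).symm hL (hf.mem_iff hL hA _).2
      rwa [Equiv.Perm.inv_def, Equiv.apply_symm_apply] at this
    · rw [← hf.mem_iff hL hA, Equiv.Perm.inv_def, Equiv.apply_symm_apply]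
      exact hx

/-- The elements of `F_S(r,L,A)` as a subgroup of the permutations of `ℝ`. -/
def groupFS {r : ℝ} {L A : Set ℝ} (hL : IsSlopeSubgroup L) (hA : IsSlopeModule r L A)
    (S : Set ℝ) : Subgroup (Equiv.Perm ℝ) where
  carrier := {f | memFS r L A S f}
  one_mem' := ⟨(groupF hL hA).one_mem, fun x hx => absurd rfl hx⟩
  mul_mem' := by
    intro f g hf hg
    refine ⟨(groupF hL hA).mul_mem hf.1 hg.1, fun x hx => ?_⟩
    by_contra hxS
    refine hx ?_
    rw [Equiv.Perm.mul_apply, not_not.1 fun h => hxS (hg.2 h), not_not.1 fun h => hxS (hf.2 h)]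
  inv_mem' := by
    intro f hf
    refine ⟨(groupF hL hA).inv_mem hf.1, fun x hx => ?_⟩
    by_contra hxS
    refine hx ?_
    rw [Equiv.Perm.inv_eq_iff_eq, not_not.1 fun h => hxS (hf.2 h)]

/-- The centralizer of `x` in `F_S(r,L,A)`. -/
def centralizerFS {r : ℝ} {L A : Set ℝ} (hL : IsSlopeSubgroup L) (hA : IsSlopeModule r L A)
    (S : Set ℝ) (x : Equiv.Perm ℝ) : Subgroup (Equiv.Perm ℝ) :=
  groupFS hL hA S ⊓ Subgroup.centralizer {x}

lemma mem_centralizerFS {r : ℝ} {L A : Set ℝ} {hL : IsSlopeSubgroup L}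
    {hA : IsSlopeModule r L A} {S : Set ℝ} {x y : Equiv.Perm ℝ} :
    y ∈ centralizerFS hL hA S x ↔ memFS r L A S y ∧ Commute x y := by
  rw [centralizerFS, Subgroup.mem_inf, Subgroup.mem_centralizer_singleton_iff]
  exact and_congr Iff.rfl eq_comm

lemma memFS.apply_of_notMem {r : ℝ} {L A S : Set ℝ} {f : Equiv.Perm ℝ} (hf : memFS r L A S f)
    {x : ℝ} (hx : x ∉ S) : f x = x :=
  not_not.1 fun h => hx (hf.2 h)

lemma memFS.mono {r : ℝ} {L A S T : Set ℝ} {f : Equiv.Perm ℝ} (hf : memFS r L A S f)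
    (hST : S ⊆ T) : memFS r L A T f :=
  ⟨hf.1, hf.2.trans hST⟩

lemma memF.strictMono {r : ℝ} {L A : Set ℝ} {f : Equiv.Perm ℝ} (hf : memF r L A f) :
    StrictMono f := by
  refine (hf.2.1.strictMono_of_inj f.injective).resolve_right fun h => ?_
  have h1 := h (show (-2 : ℝ) < -1 by norm_num)
  rw [hf.1 (-2) (by simp), hf.1 (-1) (by simp)] at h1
  norm_num at h1

lemma memF.map_right {r : ℝ} {L A : Set ℝ} {f : Equiv.Perm ℝ} (hf : memF r L A f) : f r = r :=
  hf.1 r (by simp)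

lemma memF.exists_restrict {r : ℝ} {L A : Set ℝ} (hL : IsSlopeSubgroup L)
    {f : Equiv.Perm ℝ} (hA : IsSlopeModule r L A) (hf : memF r L A f) {a b : ℝ} (ha : a ∈ A)
    (hb : b ∈ A) (h0 : 0 ≤ a) (hab : a < b) (hbr : b ≤ r) (hfa : f a = a) (hfb : f b = b) :
    ∃ g, memFS r L A (Ioo a b) g ∧ EqOn g f (Icc a b) := by
  have hinv : ∀ x, f x ∈ Ioo a b ↔ x ∈ Ioo a b := by
    intro x
    have h1 := hf.strictMono.lt_iff_lt (a := a) (b := x)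
    have h2 := hf.strictMono.lt_iff_lt (a := x) (b := b)
    rw [hfa] at h1
    rw [hfb] at h2
    exact and_congr h1 h2
  classical
  set g : Equiv.Perm ℝ := Equiv.Perm.ofSubtype (f.subtypePerm hinv) with hg
  have hin : ∀ x ∈ Ioo a b, g x = f x := fun x hx => by
    rw [hg, Equiv.Perm.ofSubtype_apply_of_mem _ hx]; rfl
  have hout : ∀ x ∉ Ioo a b, g x = x := fun x hx => Equiv.Perm.ofSubtype_apply_of_not_mem _ hx
  have hIcc : EqOn g f (Icc a b) := by
    intro x hx
    by_cases h : x ∈ Ioo a b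
    · exact hin x h
    · rw [hout x h]
      rcases hx.1.eq_or_lt with h' | h'
      · rw [← h', hfa]
      rcases hx.2.eq_or_lt with h'' | h''
      · rw [h'', hfb]
      · exact absurd ⟨h', h''⟩ h
  refine ⟨g, ⟨memF_of_locallyPL hL ?_ ?_ ?_, ?_⟩, hIcc⟩
  · exact fun x hx => hout x fun h => hx ⟨h0.trans h.1.le, h.2.trans_le hbr⟩
  · intro x
    rcases lt_trichotomy x a with h | h | h
    · exact (locallyPL_id hL x).congr isOpen_Iio h
        fun y (hy : y < a) => hout y fun h => absurd h.1 (by linarith)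
    · subst h
      exact (locallyPL_id hL x).glue (hf.locallyPL x) ha (sub_pos.2 hab)
        (fun y _ hy => hout y fun h => absurd h.1 (by linarith))
        (fun y hy hy' => hIcc ⟨hy, by linarith⟩)
    rcases lt_trichotomy x b with h' | h' | h'
    · exact (hf.locallyPL x).congr isOpen_Ioo ⟨h, h'⟩ hin
    · subst h'
      exact (hf.locallyPL x).glue (locallyPL_id hL x) hb (sub_pos.2 hab)
        (fun y hy hy' => hIcc ⟨by linarith, hy'⟩)
        (fun y hy _ => hout y fun h => absurd h.2 (by linarith))
    · exact (locallyPL_id hL x).congr isOpen_Ioi h'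
        fun y (hy : b < y) => hout y fun h => absurd h.2 (by linarith)
  · intro x hx
    by_cases h : x ∈ Ioo a b
    · rw [hin x h]; exact (hf.mem_iff hL hA x).2 hx
    · rwa [hout x h]
  · intro x hx
    by_contra h
    exact hx (hout x h)

lemma memF.finite_frontier_psupp {r : ℝ} {L A : Set ℝ} {f : Equiv.Perm ℝ}
    (hf : memF r L A f) : (frontier (psupp f)).Finite := by
  have hopen : IsOpen (psupp f) := isOpen_ne_fun hf.2.1 continuous_id
  have hsub : frontier (psupp f) ⊆ Icc 0 r := by
    refine frontier_subset_closure.trans (closure_minimal ?_ isClosed_Icc)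
    intro x hx
    by_contra h
    exact hx (hf.1 x fun h' => h (Ico_subset_Icc_self h'))
  refine (isCompact_Icc.of_isClosed_subset isClosed_frontier hsub).finite_of_isolated ?_
  intro p hp
  rw [hopen.frontier_eq] at hp
  have hfp : f p = p := not_not.1 hp.2
  obtain ⟨ε, hε, k, hk, l, hl, h1, h2, -⟩ := hf.locallyPL p
  rw [hfp] at h1 h2
  refine ⟨ε, hε, fun z hz hz1 hz2 => ?_⟩
  rw [hopen.frontier_eq] at hz
  have hfz : f z = z := not_not.1 hz.2
  by_contra hne
  rcases lt_or_gt_of_ne hne with h | h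
  · have e := h2 z hz1 h.le
    rw [hfz] at e
    have hl1 : l = 1 := by
      have : (l - 1) * (z - p) = 0 := by linarith
      rcases mul_eq_zero.1 this with h | h <;> linarith
    obtain ⟨w, hw, hw'⟩ := mem_closure_iff.1 hz.1 (Ioo (p - ε) p) isOpen_Ioo ⟨hz1, h⟩
    refine hw' ?_
    rw [h2 w hw.1 hw.2.le, hl1]; ring
  · have e := h1 z h.le hz2
    rw [hfz] at e
    have hl1 : k = 1 := by
      have : (k - 1) * (z - p) = 0 := by linarith
      rcases mul_eq_zero.1 this with h | h <;> linarith
    obtain ⟨w, hw, hw'⟩ := mem_closure_iff.1 hz.1 (Ioo p (p + ε)) isOpen_Ioo ⟨h, hz2⟩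
    refine hw' ?_
    rw [h1 w hw.1.le hw.2, hl1]; ring

lemma StrictMono.apply_eq_of_finite_of_mapsTo {α : Type*} [LinearOrder α] {f : α → α}
    (hf : StrictMono f) {S : Set α} (hS : S.Finite) (hmaps : MapsTo f S S) {p : α} (hp : p ∈ S) :
    f p = p := by
  have hiter : ∀ n, f^[n] p ∈ S := fun n => hmaps.iterate n hp
  by_contra hne
  have hinj : Function.Injective fun n => f^[n] p := by
    rcases lt_or_gt_of_ne hne with h | h
    · exact (hf.strictAnti_iterate_of_map_lt h).injective
    · exact (hf.strictMono_iterate_of_lt_map h).injective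
  exact Set.infinite_of_injective_forall_mem hinj hiter hS

lemma memF.apply_eq_of_mem_frontier {r : ℝ} {L A : Set ℝ} (hL : IsSlopeSubgroup L)
    (hA : IsSlopeModule r L A) {x y : Equiv.Perm ℝ} (hx : memF r L A x) (hy : memF r L A y)
    (hxy : Commute x y) {p : ℝ} (hp : p ∈ frontier (psupp x)) : y p = p := by
  refine hy.strictMono.apply_eq_of_finite_of_mapsTo hx.finite_frontier_psupp ?_ hp
  let e : ℝ ≃ₜ ℝ := ⟨y, hy.2.1, ((groupF hL hA).inv_mem hy).2.1⟩
  have hpre : e ⁻¹' psupp x = psupp x := by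
    ext z
    have : x (y z) = y (x z) := DFunLike.congr_fun hxy z
    change x (y z) ≠ y z ↔ x z ≠ z
    rw [this, y.injective.ne_iff]
  intro z hz
  rw [← hpre, ← e.preimage_frontier] at hz
  exact hz

lemma IsSlopeSubgroup.exists_one_lt {L : Set ℝ} (hL : IsSlopeSubgroup L) (hLne : L ≠ {1}) :
    ∃ k ∈ L, 1 < k := by
  obtain ⟨p, hp, hp1⟩ : ∃ p ∈ L, p ≠ 1 := by
    by_contra! h
    exact hLne (Set.eq_singleton_iff_unique_mem.2 ⟨hL.2.1, h⟩)
  rcases lt_or_gt_of_ne hp1 with h | h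
  · exact ⟨p⁻¹, hL.2.2.2 p hp, (one_lt_inv₀ (hL.1 p hp)).2 h⟩
  · exact ⟨p, hp, h⟩

lemma IsSlopeModule.exists_pos_lt {r : ℝ} {L A : Set ℝ} (hr : 0 < r) (hL : IsSlopeSubgroup L)
    (hLne : L ≠ {1}) (hA : IsSlopeModule r L A) {δ : ℝ} (hδ : 0 < δ) :
    ∃ s ∈ A, 0 < s ∧ s < δ := by
  obtain ⟨k, hk, hk1⟩ := hL.exists_one_lt hLne
  have hmem : ∀ n : ℕ, k⁻¹ ^ n * r ∈ A := by
    intro n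
    induction n with
    | zero => simpa using hA.1
    | succ n ih =>
      rw [pow_succ', mul_assoc]
      exact hA.2.2.2.2 _ (hL.2.2.2 k hk) _ ih
  obtain ⟨n, hn⟩ :=
    exists_pow_lt_of_lt_one (show 0 < δ / r by positivity) (inv_lt_one_of_one_lt₀ hk1)
  exact ⟨_, hmem n, by positivity, (lt_div_iff₀ hr).1 hn⟩

lemma IsSlopeModule.zsmul_mem {r : ℝ} {L A : Set ℝ} (hA : IsSlopeModule r L A) {s : ℝ}
    (hs : s ∈ A) (m : ℤ) : m * s ∈ A := by
  let S : AddSubgroup ℝ :=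
    { carrier := A
      zero_mem' := hA.2.1
      add_mem' := fun {a b} ha hb => hA.2.2.1 a ha b hb
      neg_mem' := fun {a} ha => hA.2.2.2.1 a ha }
  rw [← zsmul_eq_mul]
  exact S.zsmul_mem (x := s) hs m

lemma locallyPL_affine {L A : Set ℝ} {k c p x : ℝ} (hk : k ∈ L) :
    LocallyPL L A (fun z => c + k * (z - p)) x :=
  ⟨1, one_pos, k, hk, k, hk, fun _ _ _ => by ring, fun _ _ _ => by ring, fun _ => rfl⟩

lemma exists_bump {r : ℝ} {L A : Set ℝ} (hL : IsSlopeSubgroup L) (hA : IsSlopeModule r L A)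
    {k u s : ℝ} (hk : k ∈ L) (hk1 : 1 < k) (hu : u ∈ A) (hs : s ∈ A) (hs0 : 0 < s) (hu0 : 0 ≤ u)
    (hur : u + s + k * s ≤ r) :
    ∃ f, memFS r L A (Ioo u (u + s + k * s)) f ∧ ∀ z ∈ Ioo u (u + s + k * s), z < f z := by
  have hk0 : 0 < k := by linarith
  have hks : 0 < k * s := by positivity
  set F : ℝ → ℝ := fun z => if z ≤ u then z else if z ≤ u + s then u + k * (z - u) else
    if z ≤ u + s + k * s then u + k * s + k⁻¹ * (z - (u + s)) else z with hF
  set G : ℝ → ℝ := fun z => if z ≤ u then z else if z ≤ u + k * s then u + k⁻¹ * (z - u) else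
    if z ≤ u + s + k * s then u + s + k * (z - (u + k * s)) else z with hG
  have F1 : ∀ z, z ≤ u → F z = z := fun z h => by simp [hF, h]
  have F2 : ∀ z, u ≤ z → z ≤ u + s → F z = u + k * (z - u) := fun z h h' => by
    rcases h.eq_or_lt with h | h
    · rw [F1 z h.ge, h]; ring
    · simp [hF, h.not_ge, h']
  have F3 : ∀ z, u + s ≤ z → z ≤ u + s + k * s → F z = u + k * s + k⁻¹ * (z - (u + s)) :=
    fun z h h' => by
    rcases h.eq_or_lt with h | h
    · rw [F2 z (by linarith) h.ge, ← h]; ring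
    · simp [hF, h.not_ge, h', (show u < z by linarith).not_ge]
  have F4 : ∀ z, u + s + k * s ≤ z → F z = z := fun z h => by
    rcases h.eq_or_lt with h | h
    · rw [F3 z (by linarith) h.ge, ← h]; field_simp; ring
    · simp [hF, h.not_ge, (show u < z by linarith).not_ge, (show u + s < z by linarith).not_ge]
  have G1 : ∀ z, z ≤ u → G z = z := fun z h => by simp [hG, h]
  have G2 : ∀ z, u ≤ z → z ≤ u + k * s → G z = u + k⁻¹ * (z - u) := fun z h h' => by
    rcases h.eq_or_lt with h | h
    · rw [G1 z h.ge, h]; ring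
    · simp [hG, h.not_ge, h']
  have G3 : ∀ z, u + k * s ≤ z → z ≤ u + s + k * s → G z = u + s + k * (z - (u + k * s)) :=
    fun z h h' => by
    rcases h.eq_or_lt with h | h
    · rw [G2 z (by linarith) h.ge, ← h]; field_simp; ring
    · simp [hG, h.not_ge, h', (show u < z by linarith).not_ge]
  have G4 : ∀ z, u + s + k * s ≤ z → G z = z := fun z h => by
    rcases h.eq_or_lt with h | h
    · rw [G3 z (by linarith) h.ge, ← h]; ring
    · simp [hG, h.not_ge, (show u < z by linarith).not_ge, (show u + k * s < z by linarith).not_ge]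
  have hFG : Function.LeftInverse G F := by
    intro z
    rcases le_total z u with h | h
    · rw [F1 z h, G1 z h]
    rcases le_total z (u + s) with h' | h'
    · have := mul_le_mul_of_nonneg_left (show z - u ≤ s by linarith) hk0.le
      have := mul_nonneg hk0.le (show 0 ≤ z - u by linarith)
      rw [F2 z h h', G2 _ (by linarith) (by linarith)]; field_simp; ring
    rcases le_total z (u + s + k * s) with h'' | h''
    · have h3 : k⁻¹ * (z - (u + s)) ≤ s := by
        rw [inv_mul_le_iff₀ hk0]; linarith
      have := mul_nonneg (inv_pos.2 hk0).le (show 0 ≤ z - (u + s) by linarith)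
      rw [F3 z h' h'', G3 _ (by linarith) (by linarith)]; field_simp; ring
    · rw [F4 z h'', G4 z h'']
  have hGF : Function.RightInverse G F := by
    intro z
    rcases le_total z u with h | h
    · rw [G1 z h, F1 z h]
    rcases le_total z (u + k * s) with h' | h'
    · have h3 : k⁻¹ * (z - u) ≤ s := by
        rw [inv_mul_le_iff₀ hk0]; linarith
      have := mul_nonneg (inv_pos.2 hk0).le (show 0 ≤ z - u by linarith)
      rw [G2 z h h', F2 _ (by linarith) (by linarith)]; field_simp; ring
    rcases le_total z (u + s + k * s) with h'' | h''
    · have := mul_le_mul_of_nonneg_left (show z - (u + k * s) ≤ s by linarith) hk0.le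
      have := mul_nonneg hk0.le (show 0 ≤ z - (u + k * s) by linarith)
      rw [G3 z h' h'', F3 _ (by linarith) (by linarith)]; field_simp; ring
    · rw [G4 z h'', F4 z h'']
  have hki := hL.2.2.2 k hk
  obtain ⟨-, -, hadd, hneg, hmul⟩ := hA
  have hsub : ∀ a ∈ A, ∀ b ∈ A, a - b ∈ A := fun a ha b hb => by
    rw [sub_eq_add_neg]; exact hadd _ ha _ (hneg _ hb)
  have husA := hadd _ hu _ hs
  have hksA := hmul k hk s hs
  have hendA := hadd _ husA _ hksA
  refine ⟨⟨F, G, hFG, hGF⟩, ⟨memF_of_locallyPL hL ?_ ?_ ?_, ?_⟩, ?_⟩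
  · intro x hx
    change F x = x
    rcases le_total x u with h | h
    · exact F1 x h
    · exact F4 x (le_of_not_gt fun h' => hx ⟨by linarith, by linarith⟩)
  · intro x
    change LocallyPL L A F x
    rcases lt_trichotomy x u with h | h | h
    · exact (locallyPL_id hL x).congr isOpen_Iio h fun y hy => F1 y (le_of_lt hy)
    · rw [h]
      exact (locallyPL_id hL u).glue (locallyPL_affine hk) hu hs0 (fun y _ hy => F1 y hy)
        (fun y hy hy' => F2 y hy hy'.le)
    rcases lt_trichotomy x (u + s) with h' | h' | h'
    · exact (locallyPL_affine hk).congr isOpen_Ioo ⟨h, h'⟩ fun y hy => F2 y hy.1.le hy.2.le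
    · rw [h']
      exact (locallyPL_affine hk).glue (locallyPL_affine hki) husA (lt_min hs0 hks)
        (fun y hy hy' => F2 y (by linarith [min_le_left s (k * s)]) hy')
        (fun y hy hy' => F3 y hy (by linarith [min_le_right s (k * s)]))
    rcases lt_trichotomy x (u + s + k * s) with h'' | h'' | h''
    · exact (locallyPL_affine hki).congr isOpen_Ioo ⟨h', h''⟩ fun y hy => F3 y hy.1.le hy.2.le
    · rw [h'']
      exact (locallyPL_affine hki).glue (locallyPL_id hL _) hendA hks
        (fun y hy hy' => F3 y (by linarith) hy') (fun y hy _ => F4 y hy)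
    · exact (locallyPL_id hL x).congr isOpen_Ioi h'' fun y hy => F4 y (le_of_lt hy)
  · intro x hx
    change F x ∈ A
    rcases le_total x u with h | h
    · rwa [F1 x h]
    rcases le_total x (u + s) with h' | h'
    · rw [F2 x h h']
      exact hadd _ hu _ (hmul _ hk _ (hsub _ hx _ hu))
    rcases le_total x (u + s + k * s) with h'' | h''
    · rw [F3 x h' h'']
      exact hadd _ (hadd _ hu _ hksA) _ (hmul _ hki _ (hsub _ hx _ husA))
    · rwa [F4 x h'']
  · intro x hx
    by_contra h
    refine hx ?_
    change F x = x
    rcases le_total x u with h' | h'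
    · exact F1 x h'
    rcases h'.eq_or_lt with h'' | h''
    · exact F1 x h''.ge
    · exact F4 x (le_of_not_gt fun h3 => h ⟨h'', h3⟩)
  · intro z hz
    change z < F z
    rcases le_total z (u + s) with h' | h'
    · rw [F2 z hz.1.le h']
      nlinarith [mul_pos (sub_pos.2 hk1) (sub_pos.2 hz.1)]
    · rw [F3 z h' hz.2.le]
      have h1 : 0 < (1 - k⁻¹) * (u + s + k * s - z) :=
        mul_pos (sub_pos.2 (inv_lt_one_of_one_lt₀ hk1)) (sub_pos.2 hz.2)
      have h2 : k⁻¹ * (k * s) = s := by field_simp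
      nlinarith

lemma exists_not_commute {r : ℝ} {L A : Set ℝ} (hr : 0 < r) (hL : IsSlopeSubgroup L)
    (hLne : L ≠ {1}) (hA : IsSlopeModule r L A) {a b : ℝ} (ha : 0 ≤ a) (hab : a < b)
    (hb : b ≤ r) :
    ∃ f g, memFS r L A (Ioo a b) f ∧ memFS r L A (Ioo a b) g ∧ ¬ Commute f g := by
  obtain ⟨k, hk, hk1⟩ := hL.exists_one_lt hLne
  have hk0 : 0 < k := by linarith
  obtain ⟨s, hs, hs0, hsb⟩ := hA.exists_pos_lt hr hL hLne
    (show 0 < (b - a) / (3 + k) from div_pos (by linarith) (by linarith))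
  rw [lt_div_iff₀ (by linarith)] at hsb
  set u : ℝ := ((⌊a / s⌋ + 1 : ℤ) : ℝ) * s with hu
  have huA : u ∈ A := hA.zsmul_mem hs _
  have hau : a < u := by
    have := Int.lt_floor_add_one (a / s)
    rw [div_lt_iff₀ hs0] at this
    rw [hu]; push_cast; exact this
  have hua : u ≤ a + s := by
    have := Int.floor_le (a / s)
    rw [le_div_iff₀ hs0] at this
    rw [hu]; push_cast; linarith
  have hks : 0 < k * s := by positivity
  have hss : s < k * s := by nlinarith
  obtain ⟨f, hf, hf'⟩ := exists_bump hL hA hk hk1 huA hs hs0 (by linarith) (by linarith)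
  obtain ⟨g, hg, hg'⟩ := exists_bump hL hA hk hk1 (hA.2.2.1 _ huA _ hs) hs hs0 (by linarith)
    (by linarith)
  refine ⟨f, g, hf.mono (Ioo_subset_Ioo hau.le (by linarith)),
    hg.mono (Ioo_subset_Ioo (by linarith) (by linarith)), fun hfg => ?_⟩
  set w := u + s + k * s with hw
  have hfw : f w = w := hf.apply_of_notMem fun h => lt_irrefl _ h.2
  have hgw : w < g w := hg' w ⟨by linarith, by linarith⟩
  have hgu : g u = u := hg.apply_of_notMem fun h => by linarith [h.1]
  have hgp : g (g.symm w) = w := g.apply_symm_apply w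
  have hpw : g.symm w < w := by
    rw [← hg.1.strictMono.lt_iff_lt, hgp]; exact hgw
  have hup : u < g.symm w := by
    rw [← hg.1.strictMono.lt_iff_lt, hgp, hgu]; linarith
  have hlt := hf' _ ⟨hup, hpw⟩
  have heq : g (f (g.symm w)) = w := by
    have : f (g (g.symm w)) = g (f (g.symm w)) := DFunLike.congr_fun hfg _
    rw [← this, hgp, hfw]
  exact hlt.ne (g.injective (hgp.trans heq.symm))

lemma IsSlopeModule.exists_mem_Ioo {r : ℝ} {L A : Set ℝ} (hr : 0 < r) (hL : IsSlopeSubgroup L)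
    (hLne : L ≠ {1}) (hA : IsSlopeModule r L A) {u v : ℝ} (huv : u < v) : ∃ p ∈ A, p ∈ Ioo u v := by
  obtain ⟨s, hs, hs0, hsv⟩ := hA.exists_pos_lt hr hL hLne (sub_pos.2 huv)
  refine ⟨((⌊u / s⌋ + 1 : ℤ) : ℝ) * s, hA.zsmul_mem hs _, ?_, ?_⟩
  · have := Int.lt_floor_add_one (u / s)
    rw [div_lt_iff₀ hs0] at this
    push_cast; exact this
  · have := Int.floor_le (u / s)
    rw [le_div_iff₀ hs0] at this
    push_cast; linarith

lemma eq_one_of_commute_of_eqOn_right {r : ℝ} {L A : Set ℝ} (hL : IsSlopeSubgroup L)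
    (hA : IsSlopeModule r L A) {a b : ℝ} (hab : a < b) {x y : Equiv.Perm ℝ} (hx : memF r L A x)
    (hxa : x a = a) (hfix : ∀ p ∈ A, p ∈ Ioo a b → x p ≠ p) (hy : memFS r L A (Ioo a b) y)
    (hxy : Commute x y) {η : ℝ} (hη : 0 < η) (hyη : ∀ z, a ≤ z → z < a + η → y z = z) :
    y = 1 := by
  set S : Set ℝ := {c | c ≤ b ∧ ∀ z, a ≤ z → z ≤ c → y z = z} with hS
  have hSne : S.Nonempty := ⟨min (a + η / 2) b, min_le_right _ _, fun z hz hz' =>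
    hyη z hz (by linarith [min_le_left (a + η / 2) b])⟩
  have hSbdd : BddAbove S := ⟨b, fun c hc => hc.1⟩
  set c := sSup S with hc
  have hcb : c ≤ b := csSup_le hSne fun c hc => hc.1
  have hac : a < c := by
    refine lt_of_lt_of_le ?_ (le_csSup hSbdd (show min (a + η / 2) b ∈ S from
      ⟨min_le_right _ _, fun z hz hz' => hyη z hz (by linarith [min_le_left (a + η / 2) b])⟩))
    exact lt_min (by linarith) hab
  have hid : EqOn y id (Icc a c) := by
    rw [← closure_Ico hac.ne]
    refine Set.EqOn.closure (fun z hz => ?_) hy.1.2.1 continuous_id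
    obtain ⟨d, hd, hzd⟩ := exists_lt_of_lt_csSup hSne hz.2
    exact hd.2 z hz.1 hzd.le
  rcases hcb.eq_or_lt with h | hcb
  · ext z
    by_cases hz : z ∈ Ioo a b
    · exact hid ⟨hz.1.le, hz.2.le.trans h.ge⟩
    · exact hy.apply_of_notMem hz
  exfalso
  have key : ∀ g : Equiv.Perm ℝ, memF r L A g → g a = a → Commute g y → ¬ c < g c := by
    intro g hg hga hgy hlt
    have hmem : min (g c) b ∈ S := by
      refine ⟨min_le_right _ _, fun z hz hz' => ?_⟩
      have hz'' := hz'.trans (min_le_left _ _)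
      have e1 : g (g.symm z) = z := g.apply_symm_apply z
      have h1 : a ≤ g.symm z := by rw [← hg.strictMono.le_iff_le, e1, hga]; exact hz
      have h2 : g.symm z ≤ c := by rw [← hg.strictMono.le_iff_le, e1]; exact hz''
      have e2 : g (y (g.symm z)) = y (g (g.symm z)) := DFunLike.congr_fun hgy _
      rw [hid ⟨h1, h2⟩, id, e1] at e2
      exact e2.symm
    exact absurd (le_csSup hSbdd hmem) (not_le.2 (lt_min hlt hcb))
  by_cases hxc : x c = c
  · obtain ⟨ε, hε, k, hk, l, hl, h1, h2, h3⟩ := hy.1.locallyPL c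
    have hcA : c ∉ A := fun h => hfix c h ⟨hac, hcb⟩ hxc
    have hyc : y c = c := hid ⟨hac.le, le_rfl⟩
    have hl1 : l = 1 := by
      set z := max a (c - ε / 2) with hz
      have hza : a ≤ z := le_max_left _ _
      have hzc : z < c := max_lt hac (by linarith)
      have hzε : c - ε < z := lt_of_lt_of_le (by linarith) (le_max_right _ _)
      have e := h2 z hzε hzc.le
      rw [hid ⟨hza, hzc.le⟩, hyc, id] at e
      have : (l - 1) * (z - c) = 0 := by linarith
      rcases mul_eq_zero.1 this with h | h <;> linarith
    have hmem : min (c + ε / 2) b ∈ S := by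
      refine ⟨min_le_right _ _, fun z hz hz' => ?_⟩
      rcases le_total z c with h | h
      · exact hid ⟨hz, h⟩
      · rw [h1 z h (by linarith [min_le_left (c + ε / 2) b]), h3 hcA, hl1, hyc]; ring
    exact absurd (le_csSup hSbdd hmem) (not_le.2 (lt_min (by linarith) hcb))
  · rcases lt_or_gt_of_ne hxc with h | h
    · have hinv : memF r L A x⁻¹ := (groupF hL hA).inv_mem hx
      refine key x⁻¹ hinv ?_ hxy.inv_left ?_
      · rw [Equiv.Perm.inv_eq_iff_eq, hxa]
      · have := hinv.strictMono h
        rwa [Equiv.Perm.inv_def, Equiv.symm_apply_apply] at this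
    · exact key x hx hxa hxy h

/-- A permutation commuting with a linear contraction towards `p` and linear near `p` is linear
where the contraction is. -/
lemma apply_eq_iff_of_commute_contraction {g y : Equiv.Perm ℝ} (hgy : Commute g y) {J : Set ℝ}
    {p κ μ η : ℝ} (hκ : 0 < κ) (hκ1 : κ < 1) (hg : ∀ z ∈ J, g z = p + κ * (z - p))
    (hJ : ∀ z ∈ J, p + κ * (z - p) ∈ J) (hη : 0 < η)
    (hy : ∀ z ∈ J, |z - p| < η → y z = p + μ * (z - p)) {z w : ℝ} (hz : z ∈ J) (hw : w ∈ J) :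
    y z = w ↔ w = p + μ * (z - p) := by
  have hiter : ∀ n : ℕ, ∀ z ∈ J, (g ^ n) z = p + κ ^ n * (z - p) ∧ (g ^ n) z ∈ J := by
    intro n z hz
    induction n with
    | zero => simpa using hz
    | succ n ih =>
      rw [pow_succ', Equiv.Perm.mul_apply]
      refine ⟨?_, ?_⟩
      · rw [hg _ ih.2, ih.1]; ring
      · rw [hg _ ih.2]; exact hJ _ ih.2
  obtain ⟨n, hn⟩ := exists_pow_lt_of_lt_one
    (show 0 < η / (|z - p| + 1) by positivity) hκ1
  rw [lt_div_iff₀ (by positivity)] at hn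
  have hκn : 0 < κ ^ n := by positivity
  obtain ⟨e1, e1J⟩ := hiter n z hz
  obtain ⟨e2, -⟩ := hiter n w hw
  have e3 : y ((g ^ n) z) = p + μ * (κ ^ n * (z - p)) := by
    rw [hy _ e1J, e1]
    · ring
    · rw [e1, add_sub_cancel_left, abs_mul, abs_of_pos hκn]
      linarith
  have e4 : (g ^ n) (y z) = y ((g ^ n) z) := DFunLike.congr_fun (hgy.pow_left n) z
  rw [← (g ^ n).injective.eq_iff, e4, e3, e2]
  constructor
  · intro h
    have : κ ^ n * (w - p) = κ ^ n * (μ * (z - p)) := by linarith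
    have := mul_left_cancel₀ hκn.ne' this
    linarith
  · rintro rfl; ring

lemma exists_lt_pow_apply {x : Equiv.Perm ℝ} (hx : Continuous x) (hmono : StrictMono x)
    {a q : ℝ} (hxq : x q = q) (hlt : ∀ z ∈ Ioo a q, z < x z) {z w : ℝ} (hz : z ∈ Ioo a q)
    (hw : w < q) : ∃ n : ℕ, w < (x ^ n) z := by
  by_contra! hcon
  have hiter : ∀ n : ℕ, (x ^ n) z = x^[n] z := fun n => by rw [Equiv.Perm.iterate_eq_pow]
  have hzq : ∀ n : ℕ, x^[n] z < q := fun n => by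
    have := hmono.iterate n hz.2
    rwa [Function.iterate_fixed hxq] at this
  have hm : Monotone fun n => x^[n] z :=
    hmono.monotone.monotone_iterate_of_le_map (hlt z hz).le
  have hbdd : BddAbove (range fun n => x^[n] z) := ⟨q, by rintro _ ⟨n, rfl⟩; exact (hzq n).le⟩
  have hlim := tendsto_atTop_ciSup hm hbdd
  have hfixed : x (⨆ n, x^[n] z) = ⨆ n, x^[n] z :=
    isFixedPt_of_tendsto_iterate hlim hx.continuousAt
  have h1 : z ≤ ⨆ n, x^[n] z := le_ciSup hbdd 0
  have h2 : ⨆ n, x^[n] z ≤ w := ciSup_le fun n => by rw [← hiter]; exact hcon n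
  have := hlt _ ⟨hz.1.trans_le h1, h2.trans_lt hw⟩
  rw [hfixed] at this
  exact lt_irrefl _ this

lemma exists_slope_gap_of_lt {r : ℝ} {L A : Set ℝ} (hL : IsSlopeSubgroup L)
    (hA : IsSlopeModule r L A) {x : Equiv.Perm ℝ} (hx : memF r L A x) {a q : ℝ} (haq : a < q)
    (hxa : x a = a) (hxq : x q = q) (hlt : ∀ z ∈ Ioo a q, z < x z) :
    ∃ δ > 1, ∀ y : Equiv.Perm ℝ, memF r L A y → Commute x y → y q = q → ∀ μ η : ℝ, 0 < η →
      (∀ z, a ≤ z → z < a + η → y z = a + μ * (z - a)) → 1 < μ → δ ≤ μ := by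
  obtain ⟨ε₁, hε₁, k, hk, -, -, hr1, -, -⟩ := hx.locallyPL a
  obtain ⟨ε', hε', -, -, l, hl, -, hl1, -⟩ := hx.locallyPL q
  rw [hxa] at hr1
  rw [hxq] at hl1
  have hk0 := hL.1 k hk
  have hl0 := hL.1 l hl
  set ε := min ε₁ (q - a) with hε
  have hε0 : 0 < ε := lt_min hε₁ (by linarith)
  have hεε : ε ≤ ε₁ := min_le_left _ _
  have hεq : ε ≤ q - a := min_le_right _ _
  have hk1 : 1 < k := by
    have h1 := hlt (a + ε / 2) ⟨by linarith, by linarith⟩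
    rw [hr1 _ (by linarith) (by linarith)] at h1
    nlinarith
  have hl1' : l < 1 := by
    set z := max ((a + q) / 2) (q - ε' / 2) with hz
    have hzq : z < q := max_lt (by linarith) (by linarith)
    have hza : a < z := lt_of_lt_of_le (by linarith) (le_max_left _ _)
    have hzε : q - ε' < z := lt_of_lt_of_le (by linarith) (le_max_right _ _)
    have h1 := hlt z ⟨hza, hzq⟩
    rw [hl1 z hzε hzq.le] at h1
    nlinarith
  have hki1 : k⁻¹ < 1 := inv_lt_one_of_one_lt₀ hk1
  have hki0 : 0 < k⁻¹ := inv_pos.2 hk0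
  have hJ1 : ∀ z ∈ Ico a (a + ε), a + k⁻¹ * (z - a) ∈ Ico a (a + ε) := fun z hz => by
    have h1 := mul_nonneg hki0.le (sub_nonneg.2 hz.1)
    have h2 := mul_le_mul_of_nonneg_right hki1.le (sub_nonneg.2 hz.1)
    exact ⟨by linarith, by linarith [hz.2]⟩
  have hg1 : ∀ z ∈ Ico a (a + ε), x⁻¹ z = a + k⁻¹ * (z - a) := fun z hz => by
    have h := hJ1 z hz
    rw [Equiv.Perm.inv_eq_iff_eq, hr1 _ h.1 (by linarith [h.2])]
    field_simp; ring
  have hJ2 : ∀ z ∈ Ioc (q - ε') q, q + l * (z - q) ∈ Ioc (q - ε') q := fun z hz => by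
    have h1 := mul_nonneg hl0.le (sub_nonneg.2 hz.2)
    have h2 := mul_le_mul_of_nonneg_right hl1'.le (sub_nonneg.2 hz.2)
    exact ⟨by linarith [hz.1], by linarith⟩
  have hg2 : ∀ z ∈ Ioc (q - ε') q, x z = q + l * (z - q) := fun z hz => hl1 z hz.1 hz.2
  set z₀ := a + ε / 2 with hz₀
  obtain ⟨N, hN⟩ := exists_lt_pow_apply hx.2.1 hx.strictMono hxq hlt
    (show z₀ ∈ Ioo a q from ⟨by linarith, by linarith⟩) (show q - ε' < q by linarith)
  have hφ : memF r L A (x ^ N) := (groupF hL hA).pow_mem hx N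
  have hφq : (x ^ N) q = q := by
    rw [← Equiv.Perm.iterate_eq_pow, Function.iterate_fixed hxq]
  obtain ⟨η₁, hη₁, d, hd, -, -, hφ1, -, -⟩ := hφ.locallyPL z₀
  have hd0 := hL.1 d hd
  set η' := min η₁ (ε / 2) with hη'
  have hη'0 : 0 < η' := lt_min hη₁ (by linarith)
  have hη'1 : η' ≤ η₁ := min_le_left _ _
  have hη'2 : η' ≤ ε / 2 := min_le_right _ _
  refine ⟨(ε / 2 + η') / (ε / 2), ?_, ?_⟩
  · rw [gt_iff_lt, lt_div_iff₀ (by linarith)]; linarith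
  intro y hy hxy hyq μ η hη hyη hμ1
  by_contra! hμ
  rw [lt_div_iff₀ (by linarith)] at hμ
  have hμ0 : 0 < μ := by linarith
  obtain ⟨t, ht, ht'⟩ := exists_between (show ε / 2 < (ε / 2 + η') / μ by
    rw [lt_div_iff₀ hμ0]; linarith)
  rw [lt_div_iff₀ hμ0] at ht'
  obtain ⟨θ, hθ, -, -, ν, -, -, hν, -⟩ := hy.locallyPL q
  rw [hyq] at hν
  have hy1 : ∀ s, ε / 2 ≤ s → s * μ < ε / 2 + η' → y (a + s) = a + s * μ := by
    intro s hs hs'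
    have h1 : s ≤ s * μ := by nlinarith
    refine (apply_eq_iff_of_commute_contraction hxy.inv_left hki0 hki1 hg1 hJ1 hη
      (fun z hz hz' => hyη z hz.1 (by linarith [(abs_lt.1 hz').2]))
      (show a + s ∈ Ico a (a + ε) from ⟨by linarith, by linarith⟩)
      (show a + s * μ ∈ Ico a (a + ε) from ⟨by linarith, by linarith⟩)).2 ?_
    ring
  have hφJ : ∀ s, ε / 2 ≤ s → s < ε / 2 + η' →
      (x ^ N) (a + s) = (x ^ N) z₀ + d * (s - ε / 2) ∧ (x ^ N) (a + s) ∈ Ioc (q - ε') q := by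
    intro s hs hs'
    refine ⟨?_, ?_, ?_⟩
    · rw [hφ1 (a + s) (by linarith) (by linarith), hz₀]; ring
    · exact hN.trans_le (hφ.strictMono.monotone (by linarith))
    · rw [← hφq]
      exact hφ.strictMono.monotone (by linarith)
  have hrel : ∀ s, ε / 2 ≤ s → s * μ < ε / 2 + η' →
      (x ^ N) (a + s * μ) = q + ν * ((x ^ N) (a + s) - q) := by
    intro s hs hs'
    have h1 : s ≤ s * μ := by nlinarith
    refine (apply_eq_iff_of_commute_contraction hxy hl0 hl1' hg2 hJ2 hθ
      (fun z hz hz' => hν z (by linarith [(abs_lt.1 hz').1]) hz.2)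
      (hφJ s hs (by linarith)).2 (hφJ (s * μ) (by linarith) hs').2).1 ?_
    have e : (x ^ N) (y (a + s)) = y ((x ^ N) (a + s)) :=
      DFunLike.congr_fun (hxy.pow_left N) (a + s)
    rw [← e, hy1 s hs hs']
  have h0 : ε / 2 * μ < ε / 2 + η' := by linarith
  have e0 := hrel (ε / 2) le_rfl h0
  have e1 := hrel t ht.le ht'
  have hm0 : ε / 2 ≤ ε / 2 * μ := by nlinarith
  have hm1 : t ≤ t * μ := by nlinarith
  rw [(hφJ _ hm0 h0).1, (hφJ _ le_rfl (by linarith)).1] at e0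
  rw [(hφJ _ (ht.le.trans hm1) ht').1, (hφJ _ ht.le (by linarith)).1] at e1
  have hc : (x ^ N) z₀ < q := by
    rw [← hφq]; exact hφ.strictMono (by linarith)
  set c := (x ^ N) z₀ - q with hc'
  have hμν : μ = ν := by
    have h3 : (d * (t - ε / 2)) * μ = (d * (t - ε / 2)) * ν := by linear_combination e1 - e0
    exact mul_left_cancel₀ (mul_pos hd0 (by linarith)).ne' h3
  rw [← hμν] at e0
  have h4 : (μ - 1) * (d * (ε / 2) - c) = 0 := by rw [hc']; linear_combination e0
  rcases mul_eq_zero.1 h4 with h | h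
  · linarith
  · have : 0 < d * (ε / 2) := by positivity
    linarith

lemma exists_isLeast_fixedPoint {r : ℝ} {L A : Set ℝ} (hr : 0 < r) (hL : IsSlopeSubgroup L)
    (hLne : L ≠ {1}) (hA : IsSlopeModule r L A) {a b : ℝ} (hab : a < b) {x : Equiv.Perm ℝ}
    (hx : memF r L A x) (hxa : x a = a) (hxb : x b = b)
    (hfix : ∀ p ∈ A, p ∈ Ioo a b → x p ≠ p) :
    ∃ q, a < q ∧ x q = q ∧ ∀ z ∈ Ioo a q, x z ≠ z := by
  obtain ⟨ε, hε, k, -, -, -, h1, -, -⟩ := hx.locallyPL a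
  rw [hxa] at h1
  have hk1 : k ≠ 1 := by
    rintro rfl
    obtain ⟨p, hpA, hp⟩ := hA.exists_mem_Ioo hr hL hLne (show a < min (a + ε) b from
      lt_min (by linarith) hab)
    refine hfix p hpA ⟨hp.1, hp.2.trans_le (min_le_right _ _)⟩ ?_
    rw [h1 p hp.1.le (hp.2.trans_le (min_le_left _ _))]; ring
  have hne : ∀ z, a < z → z < a + ε → x z ≠ z := by
    intro z hz hz' h
    rw [h1 z hz.le hz'] at h
    have : (k - 1) * (z - a) = 0 := by linarith
    rcases mul_eq_zero.1 this with h | h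
    · exact hk1 (by linarith)
    · linarith
  have hK : IsCompact (Icc (min (a + ε / 2) b) b ∩ {z | x z = z}) :=
    isCompact_Icc.inter_right (isClosed_eq hx.2.1 continuous_id)
  obtain ⟨q, hq, hmin⟩ := hK.exists_isLeast ⟨b, ⟨min_le_right _ _, le_rfl⟩, hxb⟩
  refine ⟨q, (lt_min (by linarith) hab).trans_le hq.1.1, hq.2, fun z hz hxz => ?_⟩
  rcases lt_or_ge z (a + ε) with h | h
  · exact hne z hz.1 h hxz
  · have : q ≤ z := hmin ⟨⟨by linarith [min_le_left (a + ε / 2) b], hz.2.le.trans hq.1.2⟩, hxz⟩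
    linarith [hz.2]

lemma exists_slope_gap {r : ℝ} {L A : Set ℝ} (hr : 0 < r) (hL : IsSlopeSubgroup L)
    (hLne : L ≠ {1}) (hA : IsSlopeModule r L A) {a b : ℝ} (hab : a < b) {x : Equiv.Perm ℝ}
    (hx : memF r L A x) (hxa : x a = a) (hxb : x b = b)
    (hfix : ∀ p ∈ A, p ∈ Ioo a b → x p ≠ p) :
    ∃ δ > 1, ∀ y : Equiv.Perm ℝ, memF r L A y → Commute x y → y a = a → ∀ μ η : ℝ, 0 < η →
      (∀ z, a ≤ z → z < a + η → y z = a + μ * (z - a)) → 1 < μ → δ ≤ μ := by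
  obtain ⟨q, haq, hxq, hq⟩ := exists_isLeast_fixedPoint hr hL hLne hA hab hx hxa hxb hfix
  have hyq : ∀ y, memF r L A y → Commute x y → y a = a → q ≤ y q := by
    intro y hy hxy hya
    by_contra! h
    have h1 : a < y q := by rw [← hya]; exact hy.strictMono haq
    refine hq _ ⟨h1, h⟩ ?_
    have : x (y q) = y (x q) := DFunLike.congr_fun hxy q
    rw [this, hxq]
  have hyq' : ∀ y, memF r L A y → Commute x y → y a = a → y q = q := by
    intro y hy hxy hya
    refine le_antisymm ?_ (hyq y hy hxy hya)
    have h1 := hyq y⁻¹ ((groupF hL hA).inv_mem hy) hxy.inv_right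
      (by rw [Equiv.Perm.inv_eq_iff_eq, hya])
    have h2 := hy.strictMono.monotone h1
    rwa [Equiv.Perm.inv_def, Equiv.apply_symm_apply] at h2
  have hsign : (∀ z ∈ Ioo a q, z < x z) ∨ ∀ z ∈ Ioo a q, x z < z := by
    by_contra! hcon
    obtain ⟨⟨z, hz, hxz⟩, w, hw, hxw⟩ := hcon
    obtain ⟨v, hv, hxv⟩ := isPreconnected_Ioo.intermediate_value₂ hz hw
      hx.2.1.continuousOn continuousOn_id hxz hxw
    exact hq v hv hxv
  rcases hsign with h | h
  · obtain ⟨δ, hδ, H⟩ := exists_slope_gap_of_lt hL hA hx haq hxa hxq h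
    exact ⟨δ, hδ, fun y hy hxy hya => H y hy hxy (hyq' y hy hxy hya)⟩
  · have hinv : memF r L A x⁻¹ := (groupF hL hA).inv_mem hx
    obtain ⟨δ, hδ, H⟩ := exists_slope_gap_of_lt hL hA hinv haq
      (by rw [Equiv.Perm.inv_eq_iff_eq, hxa]) (by rw [Equiv.Perm.inv_eq_iff_eq, hxq])
      (fun z hz => by
        rw [← hx.strictMono.lt_iff_lt, Equiv.Perm.inv_def, Equiv.apply_symm_apply]
        exact h z hz)
    exact ⟨δ, hδ, fun y hy hxy hya => H y hy hxy.inv_left (hyq' y hy hxy hya)⟩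

/-- The graph, in `G × ℝ`, of the homomorphism mapping an element of a group `G` of permutations
fixing `a` and affine to the right of `a` to the logarithm of its slope there. -/
def logSlopeGraph (G : Subgroup (Equiv.Perm ℝ)) (a : ℝ) :
    AddSubgroup (Additive (Equiv.Perm ℝ) × ℝ) where
  carrier := {p | p.1.toMul ∈ G ∧
    ∃ η > 0, ∀ z, a ≤ z → z < a + η → p.1.toMul z = a + Real.exp p.2 * (z - a)}
  zero_mem' := ⟨G.one_mem, 1, one_pos, fun z _ _ => by simp⟩
  add_mem' := by
    rintro ⟨f, s⟩ ⟨g, t⟩ ⟨hf, η, hη, h1⟩ ⟨hg, θ, hθ, h2⟩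
    refine ⟨G.mul_mem hf hg, min θ (η / Real.exp t), by positivity, fun z hz hz' => ?_⟩
    have e1 : z - a < η / Real.exp t := by linarith [min_le_right θ (η / Real.exp t)]
    rw [lt_div_iff₀ (Real.exp_pos t)] at e1
    have e2 := mul_nonneg (Real.exp_pos t).le (sub_nonneg.2 hz)
    have e3 := h2 z hz (by linarith [min_le_left θ (η / Real.exp t)])
    change f.toMul (g.toMul z) = a + Real.exp (s + t) * (z - a)
    dsimp only at e3 h1
    rw [e3, h1 _ (by linarith) (by linarith), Real.exp_add]; ring
  neg_mem' := by
    rintro ⟨f, s⟩ ⟨hf, η, hη, h1⟩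
    refine ⟨G.inv_mem hf, η * Real.exp s, by positivity, fun z hz hz' => ?_⟩
    change f.toMul⁻¹ z = a + Real.exp (-s) * (z - a)
    have e1 : Real.exp (-s) * (z - a) < η := by
      rw [Real.exp_neg, inv_mul_lt_iff₀ (Real.exp_pos s)]; linarith
    have e2 := mul_nonneg (Real.exp_pos (-s)).le (sub_nonneg.2 hz)
    rw [Equiv.Perm.inv_eq_iff_eq]
    dsimp only at h1
    rw [h1 _ (by linarith) (by linarith), Real.exp_neg]
    field_simp; ring

lemma exists_centralizer_eq_zpow {r : ℝ} {L A : Set ℝ} (hr : 0 < r) (hL : IsSlopeSubgroup L)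
    (hLne : L ≠ {1}) (hA : IsSlopeModule r L A) {a b : ℝ} (hab : a < b) {x : Equiv.Perm ℝ}
    (hx : memFS r L A (Ioo a b) x) (hfix : ∀ p ∈ A, p ∈ Ioo a b → x p ≠ p) :
    ∃ y, memFS r L A (Ioo a b) y ∧
      {z | memFS r L A (Ioo a b) z ∧ Commute x z} = {z | memFS r L A (Ioo a b) z ∧ Commute y z} ∧
      {z | memFS r L A (Ioo a b) z ∧ Commute x z} = range fun m : ℤ => y ^ m := by
  have hfa : ∀ y, memFS r L A (Ioo a b) y → y a = a := fun y hy =>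
    hy.apply_of_notMem fun h => lt_irrefl _ h.1
  have hxb : x b = b := hx.apply_of_notMem fun h => lt_irrefl _ h.2
  obtain ⟨δ, hδ, hgap⟩ := exists_slope_gap hr hL hLne hA hab hx.1 (hfa x hx) hxb hfix
  set G := centralizerFS hL hA (Ioo a b) x with hG
  set P := logSlopeGraph G a with hP
  have hdisj : Disjoint ((P.map (AddMonoidHom.snd _ _) : AddSubgroup ℝ) : Set ℝ)
      (Ioo 0 (Real.log δ)) := by
    rw [Set.disjoint_left]
    rintro t ⟨⟨f, s⟩, ⟨hf, η, hη, hs⟩, rfl⟩ ht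
    rw [hG, mem_centralizerFS] at hf
    have h1 := hgap _ hf.1.1 hf.2 (hfa _ hf.1) _ η hη hs (Real.one_lt_exp_iff.2 ht.1)
    have h2 := (Real.log_le_iff_le_exp (by linarith)).2 h1
    exact absurd ht.2 (not_lt.2 h2)
  obtain ⟨t₀, ht₀⟩ := AddSubgroup.cyclic_of_isolated_zero (Real.log_pos hδ) hdisj
  obtain ⟨⟨y, s⟩, hyP, rfl⟩ : t₀ ∈ P.map (AddMonoidHom.snd _ _) := by
    rw [ht₀]; exact AddSubgroup.subset_closure rfl
  have hyG : y.toMul ∈ G := hyP.1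
  have hyG' := mem_centralizerFS.1 hyG
  have hpow : ∀ z, memFS r L A (Ioo a b) z → Commute x z → ∃ m : ℤ, y.toMul ^ m = z := by
    intro z hz hxz
    obtain ⟨ε, hε, k, hk, -, -, h1, -, -⟩ := hz.1.locallyPL a
    have hk0 := hL.1 k hk
    have hzP : (Additive.ofMul z, Real.log k) ∈ P := by
      refine ⟨mem_centralizerFS.2 ⟨hz, hxz⟩, ε, hε, fun w hw hw' => ?_⟩
      change z w = a + Real.exp (Real.log k) * (w - a)
      rw [h1 w hw hw', Real.exp_log hk0, hfa z hz]
    have hmem : Real.log k ∈ P.map (AddMonoidHom.snd _ _) := ⟨_, hzP, rfl⟩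
    rw [ht₀, AddSubgroup.mem_closure_singleton] at hmem
    obtain ⟨m, hm⟩ := hmem
    have hd := P.sub_mem hzP (P.zsmul_mem hyP m)
    obtain ⟨hdG, η, hη, hd⟩ := hd
    rw [mem_centralizerFS] at hdG
    refine ⟨m, ?_⟩
    have h2 := eq_one_of_commute_of_eqOn_right hL hA hab hx.1 (hfa x hx) hfix hdG.1 hdG.2 hη
      (fun w hw hw' => by
        have h3 := hd w hw hw'
        have h4 : ((Additive.ofMul z, Real.log k) - m • (y, s)).2 = 0 :=
          sub_eq_zero.2 hm.symm
        rw [h4, Real.exp_zero] at h3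
        rw [h3]; ring)
    have h5 : z / y.toMul ^ m = 1 := h2
    exact (div_eq_one.1 h5).symm
  refine ⟨y.toMul, hyG'.1, ?_, ?_⟩
  · ext z
    constructor
    · rintro ⟨hz, hxz⟩
      obtain ⟨m, rfl⟩ := hpow z hz hxz
      exact ⟨hz, (Commute.refl _).zpow_right m⟩
    · rintro ⟨hz, hyz⟩
      obtain ⟨m, hm⟩ := hpow x hx (Commute.refl x)
      refine ⟨hz, ?_⟩
      rw [← hm]
      exact hyz.zpow_left m
  · ext z
    constructor
    · rintro ⟨hz, hxz⟩
      exact hpow z hz hxz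
    · rintro ⟨m, rfl⟩
      exact mem_centralizerFS.1 (G.zpow_mem hyG m)

lemma prod_ofFn_apply_eq_self {α : Type*} {n : ℕ} (t : Fin n → Equiv.Perm α) {z : α}
    (h : ∀ i, t i z = z) : (List.ofFn t).prod z = z := by
  induction n with
  | zero => simp
  | succ n ih =>
    rw [List.ofFn_succ, List.prod_cons, Equiv.Perm.mul_apply, ih _ fun i => h i.succ, h]

lemma prod_ofFn_apply {α : Type*} {n : ℕ} (t : Fin n → Equiv.Perm α) {z : α} (j : Fin n)
    (h : ∀ i, i ≠ j → t i z = z) (h' : ∀ i, i ≠ j → t i (t j z) = t j z) :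
    (List.ofFn t).prod z = t j z := by
  induction n with
  | zero => exact j.elim0
  | succ n ih =>
    rw [List.ofFn_succ, List.prod_cons, Equiv.Perm.mul_apply]
    induction j using Fin.cases with
    | zero => rw [prod_ofFn_apply_eq_self _ fun i => h i.succ (Fin.succ_ne_zero i)]
    | succ j =>
      rw [ih (fun i => t i.succ) j (fun i hi => h i.succ fun e => hi (Fin.succ_injective _ e))
        fun i hi => h' i.succ fun e => hi (Fin.succ_injective _ e)]
      exact h' 0 (Fin.succ_ne_zero j).symm

lemma exists_mem_Ico_of_partition {αs : ℕ → ℝ} {z : ℝ} (h0 : αs 0 ≤ z) :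
    ∀ {n : ℕ}, z < αs n → ∃ i < n, z ∈ Ico (αs i) (αs (i + 1))
  | 0, hn => absurd h0 (not_le.2 hn)
  | n + 1, hn => by
    rcases le_or_gt (αs n) z with h | h
    · exact ⟨n, Nat.lt_succ_self n, h, hn⟩
    · obtain ⟨i, hi, hz⟩ := exists_mem_Ico_of_partition h0 h
      exact ⟨i, hi.trans (Nat.lt_succ_self n), hz⟩

lemma partition_le {αs : ℕ → ℝ} {n : ℕ} (hlt : ∀ i < n, αs i < αs (i + 1)) {i j : ℕ}
    (hij : i ≤ j) (hj : j ≤ n) : αs i ≤ αs j := by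
  induction j, hij using Nat.le_induction with
  | base => exact le_rfl
  | succ j hij ih => exact (ih (by omega)).trans (hlt j (by omega)).le

lemma notMem_Ioo_of_partition {αs : ℕ → ℝ} {n : ℕ} (hlt : ∀ i < n, αs i < αs (i + 1)) {i j : ℕ}
    (hi : i < n) (hj : j < n) (hij : i ≠ j) {z : ℝ} (hz : z ∈ Icc (αs j) (αs (j + 1))) :
    z ∉ Ioo (αs i) (αs (i + 1)) := by
  intro h
  rcases lt_or_gt_of_ne hij with h' | h'
  · have := partition_le hlt (show i + 1 ≤ j by omega) hj.le
    linarith [h.2, hz.1]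
  · have := partition_le hlt (show j + 1 ≤ i by omega) hi.le
    linarith [h.1, hz.2]

lemma StrictMono.apply_mem_Icc {f : ℝ → ℝ} (hf : StrictMono f) {a b : ℝ} (ha : f a = a)
    (hb : f b = b) {z : ℝ} (hz : z ∈ Icc a b) : f z ∈ Icc a b := by
  have h1 := hf.monotone hz.1
  have h2 := hf.monotone hz.2
  exact ⟨ha ▸ h1, hb ▸ h2⟩

lemma StrictMono.apply_mem_Ioo_iff {f : ℝ → ℝ} (hf : StrictMono f) {a b : ℝ} (ha : f a = a)
    (hb : f b = b) {z : ℝ} : f z ∈ Ioo a b ↔ z ∈ Ioo a b := by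
  have h1 := hf.lt_iff_lt (a := a) (b := z)
  have h2 := hf.lt_iff_lt (a := z) (b := b)
  rw [ha] at h1
  rw [hb] at h2
  exact and_congr h1 h2

section Partition

variable {r : ℝ} {L A : Set ℝ} {n : ℕ} {αs : ℕ → ℝ}

lemma memFS.apply_left {a b : ℝ} {f : Equiv.Perm ℝ} (hf : memFS r L A (Ioo a b) f) : f a = a :=
  hf.apply_of_notMem fun h => lt_irrefl _ h.1

lemma memFS.apply_right {a b : ℝ} {f : Equiv.Perm ℝ} (hf : memFS r L A (Ioo a b) f) : f b = b :=
  hf.apply_of_notMem fun h => lt_irrefl _ h.2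

lemma eqOn_prod_ofFn (hlt : ∀ i < n, αs i < αs (i + 1)) {t : Fin n → Equiv.Perm ℝ}
    (ht : ∀ i : Fin n, memFS r L A (Ioo (αs i) (αs (i + 1))) (t i)) (j : Fin n) :
    EqOn (List.ofFn t).prod (t j) (Icc (αs j) (αs (j + 1))) := by
  intro z hz
  refine prod_ofFn_apply t j (fun i hi => ?_) (fun i hi => ?_)
  · exact (ht i).apply_of_notMem
      (notMem_Ioo_of_partition hlt i.2 j.2 (fun e => hi (Fin.ext e)) hz)
  · exact (ht i).apply_of_notMem
      (notMem_Ioo_of_partition hlt i.2 j.2 (fun e => hi (Fin.ext e))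
        ((ht j).1.strictMono.apply_mem_Icc (ht j).apply_left (ht j).apply_right hz))

lemma existsUnique_prod_ofFn_iff (h0 : αs 0 = 0) (hn : αs n = r)
    (hlt : ∀ i < n, αs i < αs (i + 1)) {Hs : ℕ → Subgroup (Equiv.Perm ℝ)}
    (hHs : ∀ i < n, ∀ h ∈ Hs i, memFS r L A (Ioo (αs i) (αs (i + 1))) h) (g : Equiv.Perm ℝ) :
    (∃! t : (i : Fin n) → ↥(Hs (i : ℕ)),
        g = (List.ofFn fun i : Fin n => (t i : Equiv.Perm ℝ)).prod) ↔
      (∀ z ∉ Ico 0 r, g z = z) ∧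
        ∀ i < n, ∃ h ∈ Hs i, EqOn g h (Icc (αs i) (αs (i + 1))) := by
  have hout : ∀ t : (i : Fin n) → ↥(Hs (i : ℕ)), ∀ z ∉ Ico 0 r,
      (List.ofFn fun i : Fin n => (t i : Equiv.Perm ℝ)).prod z = z := fun t z hz =>
    prod_ofFn_apply_eq_self _ fun i => (hHs i i.2 _ (t i).2).1.1 z hz
  have hin : ∀ t : (i : Fin n) → ↥(Hs (i : ℕ)), ∀ j : Fin n,
      EqOn (List.ofFn fun i : Fin n => (t i : Equiv.Perm ℝ)).prod (t j)
        (Icc (αs j) (αs (j + 1))) := fun t j =>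
    eqOn_prod_ofFn hlt (fun i => hHs i i.2 _ (t i).2) j
  constructor
  · rintro ⟨t, rfl, -⟩
    exact ⟨hout t, fun i hi => ⟨t ⟨i, hi⟩, (t ⟨i, hi⟩).2, hin t ⟨i, hi⟩⟩⟩
  · rintro ⟨h1, h2⟩
    choose h hh hEq using h2
    refine ⟨fun i => ⟨h i i.2, hh i i.2⟩, ?_, ?_⟩
    · ext z
      by_cases hz : z ∈ Ico 0 r
      · obtain ⟨i, hi, hzi⟩ := exists_mem_Ico_of_partition (αs := αs) (h0.trans_le hz.1)
          (hz.2.trans_eq hn.symm)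
        have hzi' := Ico_subset_Icc_self hzi
        rw [hEq i hi hzi']
        exact (hin (fun i => ⟨h i i.2, hh i i.2⟩) ⟨i, hi⟩ hzi').symm
      · rw [h1 z hz]
        exact (hout (fun i => ⟨h i i.2, hh i i.2⟩) z hz).symm
    · rintro t rfl
      ext i z
      change (t i : Equiv.Perm ℝ) z = h i i.2 z
      by_cases hz : z ∈ Ioo (αs i) (αs (i + 1))
      · have hz' := Ioo_subset_Icc_self hz
        rw [← hin t i hz', hEq i i.2 hz']
      · rw [(hHs i i.2 _ (t i).2).apply_of_notMem hz,
          (hHs i i.2 _ (hh i i.2)).apply_of_notMem hz]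

lemma isInternalDirectProduct_iff (h0 : αs 0 = 0) (hn : αs n = r)
    (hlt : ∀ i < n, αs i < αs (i + 1)) {H : Subgroup (Equiv.Perm ℝ)}
    {Hs : ℕ → Subgroup (Equiv.Perm ℝ)}
    (hHs : ∀ i < n, ∀ h ∈ Hs i, memFS r L A (Ioo (αs i) (αs (i + 1))) h) :
    IsInternalDirectProduct H n Hs ↔ ∀ g, g ∈ H ↔ (∀ z ∉ Ico 0 r, g z = z) ∧
        ∀ i < n, ∃ h ∈ Hs i, EqOn g h (Icc (αs i) (αs (i + 1))) := by
  rw [IsInternalDirectProduct, and_iff_right]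
  · exact forall_congr' fun g => by rw [existsUnique_prod_ofFn_iff h0 hn hlt hHs]
  · intro i hi j hj hij f hf g hg
    refine Equiv.Perm.Disjoint.commute fun z => ?_
    by_cases hz : z ∈ Ioo (αs i) (αs (i + 1))
    · exact Or.inr ((hHs j hj g hg).apply_of_notMem
        (notMem_Ioo_of_partition hlt hj hi hij.symm (Ioo_subset_Icc_self hz)))
    · exact Or.inl ((hHs i hi f hf).apply_of_notMem hz)

lemma commute_iff_forall_mem_Ioo {x y : Equiv.Perm ℝ} {a b : ℝ} (hx : memF r L A x)
    (ha : x a = a) (hb : x b = b) (hy : memFS r L A (Ioo a b) y) :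
    Commute x y ↔ ∀ z ∈ Ioo a b, x (y z) = y (x z) := by
  refine ⟨fun h z _ => DFunLike.congr_fun h z, fun h => Equiv.ext fun z => ?_⟩
  rw [Equiv.Perm.mul_apply, Equiv.Perm.mul_apply]
  by_cases hz : z ∈ Ioo a b
  · exact h z hz
  · rw [hy.apply_of_notMem hz,
      hy.apply_of_notMem fun h' => hz ((hx.strictMono.apply_mem_Ioo_iff ha hb).1 h')]

lemma commute_congr_of_eqOn {x x' y : Equiv.Perm ℝ} {a b : ℝ} (hx : memF r L A x)
    (hx' : memFS r L A (Ioo a b) x') (ha : x a = a) (hb : x b = b)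
    (hxx' : EqOn x' x (Icc a b)) (hy : memFS r L A (Ioo a b) y) : Commute x y ↔ Commute x' y := by
  rw [commute_iff_forall_mem_Ioo hx ha hb hy,
    commute_iff_forall_mem_Ioo hx'.1 hx'.apply_left hx'.apply_right hy]
  refine forall₂_congr fun z hz => ?_
  rw [hxx' (Ioo_subset_Icc_self hz), hxx' (hy.1.strictMono.apply_mem_Icc hy.apply_left
    hy.apply_right (Ioo_subset_Icc_self hz))]

end Partition

lemma exists_partition_of_finite {D : Set ℝ} (hD : D.Finite) {a b : ℝ} (ha : IsLeast D a)
    (hb : IsGreatest D b) :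
    ∃ (n : ℕ) (αs : ℕ → ℝ), αs 0 = a ∧ αs n = b ∧ (∀ i < n, αs i < αs (i + 1)) ∧
      (∀ i ≤ n, αs i ∈ D) ∧ ∀ d ∈ D, ∃ i ≤ n, αs i = d := by
  set S := hD.toFinset with hS
  have hmem : ∀ d, d ∈ S ↔ d ∈ D := fun d => hD.mem_toFinset
  have hSne : S.Nonempty := ⟨a, (hmem a).2 ha.1⟩
  obtain ⟨n, hn⟩ : ∃ n, S.card = n + 1 := ⟨S.card - 1, by have := hSne.card_pos; omega⟩
  set e := S.orderEmbOfFin hn with he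
  have heD : ∀ i, e i ∈ D := fun i => (hmem _).1 (S.orderEmbOfFin_mem hn i)
  have hsurj : ∀ d ∈ D, ∃ i, e i = d := fun d hd => by
    have : d ∈ Set.range e := by rw [he, Finset.range_orderEmbOfFin]; exact (hmem d).2 hd
    exact this
  set αs : ℕ → ℝ := fun i => if h : i < n + 1 then e ⟨i, h⟩ else 0 with hα
  have hαe : ∀ i (h : i < n + 1), αs i = e ⟨i, h⟩ := fun i h => by rw [hα]; simp [h]
  refine ⟨n, αs, ?_, ?_, ?_, ?_, ?_⟩
  · obtain ⟨j, hj⟩ := hsurj a ha.1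
    rw [hαe 0 n.succ_pos]
    refine le_antisymm ?_ (ha.2 (heD _))
    rw [← hj, e.le_iff_le]
    exact Fin.zero_le j
  · obtain ⟨j, hj⟩ := hsurj b hb.1
    rw [hαe n n.lt_succ_self]
    refine le_antisymm (hb.2 (heD _)) ?_
    rw [← hj, e.le_iff_le]
    exact Fin.le_last j
  · intro i hi
    rw [hαe i (by omega), hαe (i + 1) (by omega), e.lt_iff_lt]
    exact Nat.lt_succ_self i
  · intro i hi
    rw [hαe i (by omega)]
    exact heD _
  · intro d hd
    obtain ⟨j, hj⟩ := hsurj d hd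
    exact ⟨j, by omega, by rw [hαe j j.2, ← hj]⟩

lemma memF.eq_self_or_ne_of_forall_notMem_frontier {r : ℝ} {L A : Set ℝ} {x : Equiv.Perm ℝ}
    (hx : memF r L A x) {a b : ℝ} (h : ∀ p ∈ A, p ∈ Ioo a b → p ∉ frontier (psupp x)) :
    (∀ p ∈ Ioo a b, x p = p) ∨ ∀ p ∈ A, p ∈ Ioo a b → x p ≠ p := by
  have hopen : IsOpen (psupp x) := isOpen_ne_fun hx.2.1 continuous_id
  by_contra! hcon
  obtain ⟨⟨q, hq, hxq⟩, p, hpA, hp, hxp⟩ := hcon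
  have hpc : p ∈ (closure (psupp x))ᶜ := fun hp' =>
    h p hpA hp (by rw [hopen.frontier_eq]; exact ⟨hp', not_not.2 hxp⟩)
  have hcover : Ioo a b ⊆ (closure (psupp x))ᶜ ∪ interior (closure (psupp x)) := by
    intro c hc
    by_cases hcc : c ∈ closure (psupp x)
    swap
    · exact Or.inl hcc
    right
    by_cases hxc : x c = c
    swap
    · exact interior_mono subset_closure (hopen.interior_eq.symm ▸ hxc)
    have hcA : c ∉ A := fun hA => h c hA hc (by rw [hopen.frontier_eq]; exact ⟨hcc, not_not.2 hxc⟩)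
    obtain ⟨ε, hε, k, -, l, -, h1, h2, h3⟩ := hx.locallyPL c
    rw [hxc] at h1 h2
    have hkl := h3 hcA
    have haff : ∀ z ∈ Ioo (c - ε) (c + ε), x z = c + k * (z - c) := by
      intro z hz
      rcases le_total c z with hz' | hz'
      · exact h1 z hz' hz.2
      · rw [hkl]; exact h2 z hz.1 hz'
    have hnhds : Ioo (c - ε) (c + ε) ∈ nhds c := Ioo_mem_nhds (by linarith) (by linarith)
    have hk1 : k ≠ 1 := by
      rintro rfl
      obtain ⟨w, hw, hxw⟩ := mem_closure_iff_nhds.1 hcc _ hnhds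
      refine hxw ?_
      rw [haff w hw]; ring
    refine mem_interior_iff_mem_nhds.2 (Filter.mem_of_superset hnhds fun z hz => ?_)
    by_cases hzc : z = c
    · rwa [hzc]
    refine subset_closure fun hxz => ?_
    rw [haff z hz] at hxz
    have : (k - 1) * (z - c) = 0 := by linarith
    rcases mul_eq_zero.1 this with h' | h'
    · exact hk1 (by linarith)
    · exact hzc (by linarith)
  have hsub := isPreconnected_Ioo.subset_left_of_subset_union isClosed_closure.isOpen_compl
    isOpen_interior (disjoint_compl_left.mono_right interior_subset) hcover ⟨p, hp, hpc⟩
  exact hsub hq (subset_closure hxq)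

lemma isInternalDirectProduct_iff_eq_centralizer {r : ℝ} {L A : Set ℝ} (hL : IsSlopeSubgroup L)
    (hA : IsSlopeModule r L A) {n : ℕ} {αs : ℕ → ℝ} (h0 : αs 0 = 0) (hn : αs n = r)
    (hlt : ∀ i < n, αs i < αs (i + 1)) (hαA : ∀ i ≤ n, αs i ∈ A) {x : Equiv.Perm ℝ}
    (hx : memF r L A x)
    (hfix : ∀ y, memF r L A y → Commute x y → ∀ i ≤ n, y (αs i) = αs i)
    {H : Subgroup (Equiv.Perm ℝ)} {Hs : ℕ → Subgroup (Equiv.Perm ℝ)}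
    (hHs : ∀ i < n, ∀ y, y ∈ Hs i ↔ memFS r L A (Ioo (αs i) (αs (i + 1))) y ∧ Commute x y) :
    IsInternalDirectProduct H n Hs ↔
      (H : Set (Equiv.Perm ℝ)) = {y : Equiv.Perm ℝ | memF r L A y ∧ Commute x y} := by
  have hHs' : ∀ i < n, ∀ h ∈ Hs i, memFS r L A (Ioo (αs i) (αs (i + 1))) h :=
    fun i hi h hh => ((hHs i hi h).1 hh).1
  rw [isInternalDirectProduct_iff h0 hn hlt hHs', Set.ext_iff]
  refine forall_congr' fun g => iff_congr Iff.rfl ⟨fun hg => ?_, fun hg => ⟨hg.1.1, fun i hi => ?_⟩⟩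
  · obtain ⟨t, rfl, -⟩ := (existsUnique_prod_ofFn_iff h0 hn hlt hHs' g).2 hg
    have hmem : (List.ofFn fun i : Fin n => (t i : Equiv.Perm ℝ)).prod ∈
        groupF hL hA ⊓ Subgroup.centralizer {x} := by
      refine Subgroup.list_prod_mem _ fun y hy => ?_
      obtain ⟨i, rfl⟩ := List.mem_ofFn.1 hy
      have := (hHs i i.2 _).1 (t i).2
      exact ⟨this.1.1, Subgroup.mem_centralizer_singleton_iff.2 this.2.symm⟩
    exact ⟨hmem.1, (Subgroup.mem_centralizer_singleton_iff.1 hmem.2).symm⟩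
  · have hxfix := hfix x hx (Commute.refl x)
    have hgfix := hfix g hg.1 hg.2
    obtain ⟨h, hh, hEq⟩ := memF.exists_restrict hL hA hg.1 (hαA i hi.le) (hαA (i + 1) hi)
      (h0 ▸ partition_le hlt i.zero_le hi.le) (hlt i hi) (hn ▸ partition_le hlt hi le_rfl)
      (hgfix i hi.le) (hgfix (i + 1) hi)
    refine ⟨h, (hHs i hi h).2 ⟨hh, ?_⟩, hEq.symm⟩
    rw [commute_iff_forall_mem_Ioo hx (hxfix i hi.le) (hxfix (i + 1) hi) hh]
    intro z hz
    have hz' := Ioo_subset_Icc_self hz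
    rw [hEq hz', hEq (hx.strictMono.apply_mem_Icc (hxfix i hi.le) (hxfix (i + 1) hi) hz')]
    exact DFunLike.congr_fun hg.2 z

lemma range_zpow_ne_memFS {r : ℝ} {L A : Set ℝ} (hr : 0 < r) (hL : IsSlopeSubgroup L)
    (hLne : L ≠ {1}) (hA : IsSlopeModule r L A) {a b : ℝ} (ha : 0 ≤ a) (hab : a < b)
    (hb : b ≤ r) (x : Equiv.Perm ℝ) :
    (range fun m : ℤ => x ^ m) ≠ {y | memFS r L A (Ioo a b) y} := by
  intro h
  obtain ⟨f, g, hf, hg, hfg⟩ := exists_not_commute hr hL hLne hA ha hab hb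
  obtain ⟨k, rfl⟩ : f ∈ range fun m : ℤ => x ^ m := h ▸ hf
  obtain ⟨l, rfl⟩ : g ∈ range fun m : ℤ => x ^ m := h ▸ hg
  exact hfg ((Commute.refl x).zpow_zpow k l)

lemma exists_ne_of_centralizer_eq_zpow {r : ℝ} {L A : Set ℝ} (hr : 0 < r)
    (hL : IsSlopeSubgroup L) (hLne : L ≠ {1}) (hA : IsSlopeModule r L A) {a b u v : ℝ}
    {x : Equiv.Perm ℝ} (ha : 0 ≤ a) (hb : b ≤ r) (hau : a ≤ u) (huv : u < v) (hvb : v ≤ b)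
    (hcyc : {y | memFS r L A (Ioo a b) y ∧ Commute x y} = range fun m : ℤ => x ^ m) :
    ∃ z ∈ Ioo u v, x z ≠ z := by
  by_contra! hid
  obtain ⟨f, g, hf, hg, hfg⟩ :=
    exists_not_commute hr hL hLne hA (ha.trans hau) huv (hvb.trans hb)
  have hmem : ∀ y, memFS r L A (Ioo u v) y → y ∈ range fun m : ℤ => x ^ m := by
    intro y hy
    rw [← hcyc]
    refine ⟨hy.mono (Ioo_subset_Ioo hau hvb), Equiv.Perm.Disjoint.commute fun z => ?_⟩
    by_cases hz : z ∈ Ioo u v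
    · exact Or.inl (hid z hz)
    · exact Or.inr (hy.apply_of_notMem hz)
  obtain ⟨k, rfl⟩ := hmem f hf
  obtain ⟨l, rfl⟩ := hmem g hg
  exact hfg ((Commute.refl x).zpow_zpow k l)

lemma memF.mem_frontier_of_mem_closure {r : ℝ} {L A : Set ℝ} {x : Equiv.Perm ℝ}
    (hx : memF r L A x) {p : ℝ} (hp : p ∈ closure (psupp x)) (hxp : x p = p) :
    p ∈ frontier (psupp x) := by
  have hopen : IsOpen (psupp x) := isOpen_ne_fun hx.2.1 continuous_id
  rw [hopen.frontier_eq]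
  exact ⟨hp, not_not.2 hxp⟩

lemma memF.exists_partition {r : ℝ} {L A : Set ℝ} (hr : 0 < r)
    (hA : IsSlopeModule r L A) {x : Equiv.Perm ℝ} (hx : memF r L A x) :
    ∃ (n : ℕ) (αs : ℕ → ℝ), αs 0 = 0 ∧ αs n = r ∧ (∀ i < n, αs i < αs (i + 1)) ∧
      (∀ i ≤ n, αs i ∈ A) ∧ (∀ i, i + 1 < n → αs (i + 1) ∈ frontier (psupp x)) ∧
      ∀ i < n, ∀ p ∈ A, p ∈ Ioo (αs i) (αs (i + 1)) → p ∉ frontier (psupp x) := by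
  have hsub : frontier (psupp x) ⊆ Icc 0 r :=
    frontier_subset_closure.trans (closure_minimal
      (fun z hz => Ico_subset_Icc_self (by_contra fun h => hz (hx.1 z h))) isClosed_Icc)
  set D : Set ℝ := insert 0 (insert r (frontier (psupp x) ∩ A)) with hD
  have hD0 : IsLeast D 0 := by
    refine ⟨mem_insert _ _, ?_⟩
    rintro d (rfl | rfl | hd)
    exacts [le_rfl, hr.le, (hsub hd.1).1]
  have hDr : IsGreatest D r := by
    refine ⟨mem_insert_of_mem _ (mem_insert _ _), ?_⟩
    rintro d (rfl | rfl | hd)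
    exacts [hr.le, le_rfl, (hsub hd.1).2]
  obtain ⟨n, αs, h0, hn, hlt, hmem, hsurj⟩ := exists_partition_of_finite
    (((hx.finite_frontier_psupp.inter_of_left A).insert r).insert 0) hD0 hDr
  refine ⟨n, αs, h0, hn, hlt, fun i hi => ?_, fun i hi => ?_, fun i hi p hpA hp hpf => ?_⟩
  · rcases hmem i hi with h | h | h
    exacts [h ▸ hA.2.1, h ▸ hA.1, h.2]
  · have h1 := partition_le hlt i.zero_le (by omega)
    have h2 := hlt i (by omega)
    have h3 := hlt (i + 1) hi
    have h4 := partition_le hlt (show i + 1 + 1 ≤ n by omega) le_rfl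
    rcases hmem (i + 1) hi.le with h | h | h
    · linarith
    · linarith
    · exact h.1
  · obtain ⟨j, hj, rfl⟩ := hsurj p (mem_insert_of_mem _ (mem_insert_of_mem _ ⟨hpf, hpA⟩))
    rcases Nat.lt_or_ge i j with h | h
    · exact absurd (partition_le hlt (show i + 1 ≤ j from h) hj) (not_le.2 hp.2)
    · exact absurd (partition_le hlt h hi.le) (not_le.2 hp.1)

lemma apply_partition_eq {r : ℝ} {L A : Set ℝ} (hL : IsSlopeSubgroup L)
    (hA : IsSlopeModule r L A) {n : ℕ} {αs : ℕ → ℝ} (h0 : αs 0 = 0) (hn : αs n = r)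
    {x : Equiv.Perm ℝ} (hx : memF r L A x)
    (hfr : ∀ i, i + 1 < n → αs (i + 1) ∈ frontier (psupp x)) {y : Equiv.Perm ℝ}
    (hy : memF r L A y) (hxy : Commute x y) {i : ℕ} (hi : i ≤ n) : y (αs i) = αs i := by
  rcases hi.eq_or_lt with rfl | hi
  · rw [hn, hy.map_right]
  cases i with
  | zero => rw [h0, hy.map_zero]
  | succ i => exact memF.apply_eq_of_mem_frontier hL hA hx hy hxy (hfr i hi)

lemma exists_decomposition_of_centralizer {r : ℝ} {L A : Set ℝ} (hr : 0 < r)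
    (hL : IsSlopeSubgroup L) (hLne : L ≠ {1}) (hA : IsSlopeModule r L A) {x : Equiv.Perm ℝ}
    (hx : memF r L A x) {H : Subgroup (Equiv.Perm ℝ)}
    (hH : (H : Set (Equiv.Perm ℝ)) = {y : Equiv.Perm ℝ | memF r L A y ∧ Commute x y}) :
    ∃ (n : ℕ) (αs : ℕ → ℝ) (Hs : ℕ → Subgroup (Equiv.Perm ℝ)),
      αs 0 = 0 ∧ αs n = r ∧ (∀ i < n, αs i < αs (i + 1)) ∧ (∀ i ≤ n, αs i ∈ A) ∧
      IsInternalDirectProduct H n Hs ∧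
      (∀ i < n,
        ((Hs i : Set (Equiv.Perm ℝ)) =
            {y : Equiv.Perm ℝ | memFS r L A (Ioo (αs i) (αs (i + 1))) y}) ∨
        (∃ x : Equiv.Perm ℝ, memFS r L A (Ioo (αs i) (αs (i + 1))) x ∧
          (Hs i : Set (Equiv.Perm ℝ)) =
            {y : Equiv.Perm ℝ |
              memFS r L A (Ioo (αs i) (αs (i + 1))) y ∧ Commute x y} ∧
          (Hs i : Set (Equiv.Perm ℝ)) = Set.range fun m : ℤ => x ^ m)) ∧
      (∀ i, i + 1 < n →
        (Hs i : Set (Equiv.Perm ℝ)) =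
          {y : Equiv.Perm ℝ | memFS r L A (Ioo (αs i) (αs (i + 1))) y} →
        (Hs (i + 1) : Set (Equiv.Perm ℝ)) ≠
          {y : Equiv.Perm ℝ | memFS r L A (Ioo (αs (i + 1)) (αs (i + 2))) y}) := by
  obtain ⟨n, αs, h0, hn, hlt, hαA, hfr, hno⟩ := hx.exists_partition hr hA
  have hxfix : ∀ i ≤ n, x (αs i) = αs i := fun i hi =>
    apply_partition_eq hL hA h0 hn hx hfr hx (Commute.refl x) hi
  have hα0 : ∀ i ≤ n, 0 ≤ αs i := fun i hi => h0 ▸ partition_le hlt i.zero_le hi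
  have hαr : ∀ i ≤ n, αs i ≤ r := fun i hi => hn ▸ partition_le hlt hi le_rfl
  have hcoe : ∀ i, (centralizerFS hL hA (Ioo (αs i) (αs (i + 1))) x : Set (Equiv.Perm ℝ)) =
      {y | memFS r L A (Ioo (αs i) (αs (i + 1))) y ∧ Commute x y} :=
    fun i => Set.ext fun y => mem_centralizerFS
  have hcase : ∀ i < n, (∀ p ∈ Ioo (αs i) (αs (i + 1)), x p = p) ∨
      ∃ w, memFS r L A (Ioo (αs i) (αs (i + 1))) w ∧
        {y | memFS r L A (Ioo (αs i) (αs (i + 1))) y ∧ Commute x y} =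
          {y | memFS r L A (Ioo (αs i) (αs (i + 1))) y ∧ Commute w y} ∧
        {y | memFS r L A (Ioo (αs i) (αs (i + 1))) y ∧ Commute x y} =
          range fun m : ℤ => w ^ m := by
    intro i hi
    refine (hx.eq_self_or_ne_of_forall_notMem_frontier (hno i hi)).imp_right fun hne => ?_
    obtain ⟨x', hx', hEq⟩ := memF.exists_restrict hL hA hx (hαA i hi.le) (hαA (i + 1) hi)
      (hα0 i hi.le) (hlt i hi) (hαr (i + 1) hi) (hxfix i hi.le) (hxfix (i + 1) hi)
    have hcongr : {y | memFS r L A (Ioo (αs i) (αs (i + 1))) y ∧ Commute x y} =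
        {y | memFS r L A (Ioo (αs i) (αs (i + 1))) y ∧ Commute x' y} :=
      Set.ext fun y => and_congr_right fun hy =>
        commute_congr_of_eqOn hx hx' (hxfix i hi.le) (hxfix (i + 1) hi) hEq hy
    rw [hcongr]
    refine exists_centralizer_eq_zpow hr hL hLne hA (hlt i hi) hx' fun p hpA hp => ?_
    rw [hEq (Ioo_subset_Icc_self hp)]
    exact hne p hpA hp
  have hid : ∀ i < n, {y | memFS r L A (Ioo (αs i) (αs (i + 1))) y ∧ Commute x y} =
      {y | memFS r L A (Ioo (αs i) (αs (i + 1))) y} →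
      ∀ p ∈ Ioo (αs i) (αs (i + 1)), x p = p := by
    intro i hi hfull
    refine (hcase i hi).resolve_right ?_
    rintro ⟨w, -, -, hw⟩
    exact range_zpow_ne_memFS hr hL hLne hA (hα0 i hi.le) (hlt i hi) (hαr (i + 1) hi) w
      (hw.symm.trans hfull)
  refine ⟨n, αs, fun i => centralizerFS hL hA (Ioo (αs i) (αs (i + 1))) x, h0, hn, hlt, hαA,
    (isInternalDirectProduct_iff_eq_centralizer hL hA h0 hn hlt hαA hx
      (fun y hy hxy i hi => apply_partition_eq hL hA h0 hn hx hfr hy hxy hi)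
      fun i _ y => mem_centralizerFS).2 hH, fun i hi => ?_, fun i hi h1 h2 => ?_⟩
  · simp only [hcoe]
    refine (hcase i hi).imp_left fun hid => ?_
    refine Set.ext fun y => and_iff_left_of_imp fun hy => ?_
    refine Equiv.Perm.Disjoint.commute fun z => ?_
    by_cases hz : z ∈ Ioo (αs i) (αs (i + 1))
    · exact Or.inl (hid z hz)
    · exact Or.inr (hy.apply_of_notMem hz)
  · rw [hcoe] at h1 h2
    have hid1 := hid i (by omega) h1
    have hid2 := hid (i + 1) hi h2
    obtain ⟨z, hz, hxz⟩ := mem_closure_iff_nhds.1 (frontier_subset_closure (hfr i hi)) _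
      (Ioo_mem_nhds (hlt i (by omega)) (hlt (i + 1) hi))
    refine hxz ?_
    rcases lt_trichotomy z (αs (i + 1)) with h | h | h
    · exact hid1 z ⟨hz.1, h⟩
    · rw [h, hxfix (i + 1) hi.le]
    · exact hid2 z ⟨h, hz.2⟩

lemma exists_eq_centralizer_of_decomposition {r : ℝ} {L A : Set ℝ} (hr : 0 < r)
    (hL : IsSlopeSubgroup L) (hLne : L ≠ {1}) (hA : IsSlopeModule r L A)
    {H : Subgroup (Equiv.Perm ℝ)} {n : ℕ} {αs : ℕ → ℝ} {Hs : ℕ → Subgroup (Equiv.Perm ℝ)}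
    (h0 : αs 0 = 0) (hn : αs n = r) (hlt : ∀ i < n, αs i < αs (i + 1))
    (hαA : ∀ i ≤ n, αs i ∈ A) (hprod : IsInternalDirectProduct H n Hs)
    (hfac : ∀ i < n,
      ((Hs i : Set (Equiv.Perm ℝ)) =
          {y : Equiv.Perm ℝ | memFS r L A (Ioo (αs i) (αs (i + 1))) y}) ∨
      (∃ x : Equiv.Perm ℝ, memFS r L A (Ioo (αs i) (αs (i + 1))) x ∧
        (Hs i : Set (Equiv.Perm ℝ)) =
          {y : Equiv.Perm ℝ |
            memFS r L A (Ioo (αs i) (αs (i + 1))) y ∧ Commute x y} ∧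
        (Hs i : Set (Equiv.Perm ℝ)) = Set.range fun m : ℤ => x ^ m))
    (hcons : ∀ i, i + 1 < n →
      (Hs i : Set (Equiv.Perm ℝ)) =
        {y : Equiv.Perm ℝ | memFS r L A (Ioo (αs i) (αs (i + 1))) y} →
      (Hs (i + 1) : Set (Equiv.Perm ℝ)) ≠
        {y : Equiv.Perm ℝ | memFS r L A (Ioo (αs (i + 1)) (αs (i + 2))) y}) :
    ∃ x : Equiv.Perm ℝ, memF r L A x ∧
      (H : Set (Equiv.Perm ℝ)) = {y : Equiv.Perm ℝ | memF r L A y ∧ Commute x y} := by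
  have hα0 : ∀ i ≤ n, 0 ≤ αs i := fun i hi => h0 ▸ partition_le hlt i.zero_le hi
  have hαr : ∀ i ≤ n, αs i ≤ r := fun i hi => hn ▸ partition_le hlt hi le_rfl
  have hxs : ∀ i : Fin n, ∃ w, memFS r L A (Ioo (αs i) (αs (i + 1))) w ∧
      (∀ y, y ∈ Hs i ↔ memFS r L A (Ioo (αs i) (αs (i + 1))) y ∧ Commute w y) ∧
      ((Hs i : Set (Equiv.Perm ℝ)) ≠ {y | memFS r L A (Ioo (αs i) (αs (i + 1))) y} →
        ∀ u v, αs i ≤ u → u < v → v ≤ αs (i + 1) → ∃ z ∈ Ioo u v, w z ≠ z) := by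
    intro i
    rcases hfac i i.2 with h | ⟨w, hw, h1, h2⟩
    · exact ⟨1, (groupFS hL hA _).one_mem,
        fun y => (Set.ext_iff.1 h y).trans (and_iff_left (Commute.one_left y)).symm,
        fun hne => absurd h hne⟩
    · exact ⟨w, hw, Set.ext_iff.1 h1, fun _ u v hu huv hv =>
        exists_ne_of_centralizer_eq_zpow hr hL hLne hA (hα0 i i.2.le) (hαr (i + 1) i.2) hu huv hv
          (h1.symm.trans h2)⟩
  choose xs hxs hHs hne using hxs
  set x := (List.ofFn xs).prod with hxdef
  have hx : memF r L A x := by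
    refine (groupF hL hA).list_prod_mem fun y hy => ?_
    obtain ⟨i, rfl⟩ := List.mem_ofFn.1 hy
    exact (hxs i).1
  have hEq : ∀ i : Fin n, EqOn (xs i) x (Icc (αs i) (αs (i + 1))) :=
    fun i => (eqOn_prod_ofFn hlt hxs i).symm
  have hxl : ∀ i < n, x (αs i) = αs i := fun i hi => by
    rw [← hEq ⟨i, hi⟩ (left_mem_Icc.2 (hlt i hi).le), (hxs ⟨i, hi⟩).apply_left]
  have hxr : ∀ i < n, x (αs (i + 1)) = αs (i + 1) := fun i hi => by
    rw [← hEq ⟨i, hi⟩ (right_mem_Icc.2 (hlt i hi).le), (hxs ⟨i, hi⟩).apply_right]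
  have hfr : ∀ i, i + 1 < n → αs (i + 1) ∈ frontier (psupp x) := by
    intro i hi
    have hi' : i < n := by omega
    refine hx.mem_frontier_of_mem_closure (Metric.mem_closure_iff.2 fun ε hε => ?_) (hxl _ hi)
    by_cases hfull : (Hs i : Set (Equiv.Perm ℝ)) =
        {y | memFS r L A (Ioo (αs i) (αs (i + 1))) y}
    · obtain ⟨z, hz, hxz⟩ := hne ⟨i + 1, hi⟩ (hcons i hi hfull) (αs (i + 1))
        (min (αs (i + 1) + ε) (αs (i + 1 + 1))) le_rfl
        (lt_min (by linarith) (hlt (i + 1) hi)) (min_le_right _ _)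
      have hz2 := lt_min_iff.1 hz.2
      refine ⟨z, ?_, ?_⟩
      · change x z ≠ z
        rwa [← hEq ⟨i + 1, hi⟩ ⟨hz.1.le, hz2.2.le⟩]
      · rw [Real.dist_eq, abs_sub_lt_iff]
        constructor <;> linarith [hz.1, hz2.1]
    · obtain ⟨z, hz, hxz⟩ := hne ⟨i, hi'⟩ hfull (max (αs (i + 1) - ε) (αs i)) (αs (i + 1))
        (le_max_right _ _) (max_lt (by linarith) (hlt i hi')) le_rfl
      have hz1 := max_lt_iff.1 hz.1
      refine ⟨z, ?_, ?_⟩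
      · change x z ≠ z
        rwa [← hEq ⟨i, hi'⟩ ⟨hz1.2.le, hz.2.le⟩]
      · rw [Real.dist_eq, abs_sub_lt_iff]
        constructor <;> linarith [hz.2, hz1.1]
  refine ⟨x, hx, (isInternalDirectProduct_iff_eq_centralizer hL hA h0 hn hlt hαA hx
    (fun y hy hxy i hi => apply_partition_eq hL hA h0 hn hx hfr hy hxy hi)
    fun i hi y => ?_).1 hprod⟩
  rw [hHs ⟨i, hi⟩]
  exact and_congr_right fun hy =>
    (commute_congr_of_eqOn hx (hxs ⟨i, hi⟩) (hxl i hi) (hxr i hi) (hEq ⟨i, hi⟩) hy).symm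

/-- A subgroup `H` of `F` is the centralizer in `F` of a single
element if and only if `H` decomposes as an internal direct product of subgroups
`H₁, …, Hₙ` along a partition `0 = α₀ < α₁ < ⋯ < αₙ = r` with all `αᵢ ∈ A`, where
each `Hᵢ` is either the whole of `F_{(αᵢ₋₁,αᵢ)}`, or is the centralizer of some
element `x` of `F_{(αᵢ₋₁,αᵢ)}` in `F_{(αᵢ₋₁,αᵢ)}` and is the cyclic group `⟨x⟩`;
and no two consecutive factors are both full groups `F_{(αᵢ₋₁,αᵢ)}`. -/
theorem centralizer_characterization (r : ℝ) (L A : Set ℝ) (hr : 0 < r)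
    (hL : IsSlopeSubgroup L) (hLne : L ≠ {1}) (hA : IsSlopeModule r L A)
    (H : Subgroup (Equiv.Perm ℝ)) (hH : ∀ h ∈ H, memF r L A h) :
    (∃ x : Equiv.Perm ℝ, memF r L A x ∧
        (H : Set (Equiv.Perm ℝ)) = {y : Equiv.Perm ℝ | memF r L A y ∧ Commute x y}) ↔
      ∃ (n : ℕ) (αs : ℕ → ℝ) (Hs : ℕ → Subgroup (Equiv.Perm ℝ)),
        αs 0 = 0 ∧ αs n = r ∧ (∀ i < n, αs i < αs (i + 1)) ∧ (∀ i ≤ n, αs i ∈ A) ∧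
        IsInternalDirectProduct H n Hs ∧
        (∀ i < n,
          ((Hs i : Set (Equiv.Perm ℝ)) =
              {y : Equiv.Perm ℝ | memFS r L A (Ioo (αs i) (αs (i + 1))) y}) ∨
          (∃ x : Equiv.Perm ℝ, memFS r L A (Ioo (αs i) (αs (i + 1))) x ∧
            (Hs i : Set (Equiv.Perm ℝ)) =
              {y : Equiv.Perm ℝ |
                memFS r L A (Ioo (αs i) (αs (i + 1))) y ∧ Commute x y} ∧
            (Hs i : Set (Equiv.Perm ℝ)) = Set.range fun m : ℤ => x ^ m)) ∧
        (∀ i, i + 1 < n →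
          (Hs i : Set (Equiv.Perm ℝ)) =
            {y : Equiv.Perm ℝ | memFS r L A (Ioo (αs i) (αs (i + 1))) y} →
          (Hs (i + 1) : Set (Equiv.Perm ℝ)) ≠
            {y : Equiv.Perm ℝ | memFS r L A (Ioo (αs (i + 1)) (αs (i + 2))) y}) := by
  constructor
  · rintro ⟨x, hx, hHx⟩
    exact exists_decomposition_of_centralizer hr hL hLne hA hx hHx
  · rintro ⟨n, αs, Hs, h0, hn, hlt, hαA, hprod, hfac, hcons⟩
    exact exists_eq_centralizer_of_decomposition hr hL hLne hA h0 hn hlt hαA hprod hfac hcons
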